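/- arXiv:2404.01634 — 2 statements merged into one kernel-verified Lean document; each statement's English description precedes it below -/
import Mathlib

section
/- Assume p > 0, (H1), and let (λ_n, μ_n, u_n) be a sequence of solutions of (q) with μ_n → ∞. Let γ_{0,n} > 0 satisfy p·λ_n·μ_n^{p−1}·f(μ_n)·γ_{0,n}² = 1 and set z_{0,n}(r) = p·μ_n^{p−1}·(u_n(γ_{0,n}·r) − μ_n) for r ∈ [0, 1/γ_{0,n}]. Then, up to a subsequence, there exists a sequence (ρ_{0,n}) ⊂ (0,1) such that γ_{0,n} → 0, ρ_{0,n} → 0, ρ_{0,n}/γ_{0,n} → ∞, u_n(ρ_{0,n})/μ_n → 1, and ‖z_{0,n} − z₀‖_{C¹([0, ρ_{0,n}/γ_{0,n}])} → 0, where z₀(r) = log(64/(8 + r²)²) solves −z₀'' − z₀'/r = e^{z₀} on (0,∞) with z₀(0) = 0 = z₀'(0); moreover p·μ_n^{p−1}·∫₀^{ρ_{0,n}} λ_n f(u_n(r))·r dr → ∫₀^∞ e^{z₀(r)}·r dr = 4. Furthermore there exists a sequence (r_{0,n}) ⊂ (0, ρ_{0,n}) such that r_{0,n}/γ_{0,n}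 → 2√2, u_n(r_{0,n})/μ_n → 1, and p·λ_n·r_{0,n}²·u_n(r_{0,n})^{p−1}·f(u_n(r_{0,n})) → 2 as n → ∞. -/
open Filter

/-- The limit profile of the first (standard) bubble. -/
noncomputable def z0 (r : ℝ) : ℝ := Real.log (64 / (8 + r ^ 2) ^ 2)

open Set Topology

lemma exp_z0 (r : ℝ) : Real.exp (z0 r) = 64 / (8 + r ^ 2) ^ 2 :=
  Real.exp_log (by positivity)

lemma z0_zero : z0 0 = 0 := by norm_num [z0]

lemma z0_nonpos (r : ℝ) : z0 r ≤ 0 := by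
  refine Real.log_nonpos (by positivity) ?_
  rw [div_le_one (by positivity)]
  nlinarith [sq_nonneg r, sq_nonneg (r ^ 2)]

lemma hasDerivAt_z0 (r : ℝ) : HasDerivAt z0 (-(4 * r / (8 + r ^ 2))) r := by
  have h1 : HasDerivAt (fun r : ℝ => 8 + r ^ 2) (2 * r) r := by
    simpa using (hasDerivAt_pow 2 r).const_add 8
  have h2 := (h1.log (by positivity)).const_mul 2 |>.const_sub (Real.log 64)
  have h3 : z0 = fun r => Real.log 64 - 2 * Real.log (8 + r ^ 2) := by
    funext r
    rw [z0, Real.log_div (by positivity) (by positivity), Real.log_pow]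
    norm_num
  rw [h3]
  exact h2.congr_deriv (by ring)

lemma deriv_z0 : deriv z0 = fun r => -(4 * r / (8 + r ^ 2)) :=
  funext fun r => (hasDerivAt_z0 r).deriv

lemma z0_ode {r : ℝ} (hr : 0 < r) : -(deriv (deriv z0) r) - deriv z0 r / r = Real.exp (z0 r) := by
  have h1 : HasDerivAt (fun r : ℝ => 8 + r ^ 2) (2 * r) r := by
    simpa using (hasDerivAt_pow 2 r).const_add 8
  have h2 : HasDerivAt (fun r : ℝ => 4 * r) 4 r := by
    simpa using (hasDerivAt_id r).const_mul 4
  have h3 : HasDerivAt (fun r : ℝ => -(4 * r / (8 + r ^ 2))) _ r :=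
    (h2.div h1 (by positivity)).neg
  rw [deriv_z0, h3.deriv, exp_z0]
  field_simp
  ring

lemma hasDerivAt_mass_z0 (r : ℝ) :
    HasDerivAt (fun r : ℝ => 4 * r ^ 2 / (8 + r ^ 2)) (Real.exp (z0 r) * r) r := by
  have h1 : HasDerivAt (fun r : ℝ => 8 + r ^ 2) (2 * r) r := by
    simpa using (hasDerivAt_pow 2 r).const_add 8
  have h2 : HasDerivAt (fun r : ℝ => 4 * r ^ 2) (4 * (2 * r)) r := by
    simpa using (hasDerivAt_pow 2 r).const_mul 4
  refine (h2.div h1 (by positivity)).congr_deriv ?_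
  rw [exp_z0]
  field_simp
  ring

lemma continuous_z0 : Continuous z0 :=
  continuous_iff_continuousAt.2 fun r => (hasDerivAt_z0 r).continuousAt

lemma integral_mass_z0 (r : ℝ) :
    ∫ s in (0:ℝ)..r, s * Real.exp (z0 s) = 4 * r ^ 2 / (8 + r ^ 2) := by
  have := intervalIntegral.integral_eq_sub_of_hasDerivAt (a := 0) (b := r)
    (fun s _ => hasDerivAt_mass_z0 s)
    ((continuous_z0.rexp.mul continuous_id).intervalIntegrable 0 r)
  simpa [mul_comm] using this

lemma tendsto_mass_z0 : Tendsto (fun r : ℝ => 4 * r ^ 2 / (8 + r ^ 2)) atTop (𝓝 4) := by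
  have h1 : Tendsto (fun r : ℝ => 8 + r ^ 2) atTop atTop :=
    tendsto_atTop_add_const_left _ _ (tendsto_pow_atTop two_ne_zero)
  have h2 := (h1.inv_tendsto_atTop.const_mul 32).const_sub 4
  simp only [mul_zero, sub_zero] at h2
  refine h2.congr fun r => ?_
  simp only [Pi.inv_apply]
  field_simp
  ring

lemma integral_Ioi_mass_z0 : ∫ r in Ioi (0:ℝ), Real.exp (z0 r) * r = 4 := by
  have := MeasureTheory.integral_Ioi_of_hasDerivAt_of_nonneg' (a := 0)
    (fun s _ => hasDerivAt_mass_z0 s)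
    (fun s (hs : 0 < s) => by positivity) tendsto_mass_z0
  simpa using this

lemma abs_exp_sub_exp_le {a b : ℝ} (ha : a ≤ 0) (hb : b ≤ 0) :
    |Real.exp a - Real.exp b| ≤ |a - b| := by
  have key : ∀ a b : ℝ, a ≤ 0 → b ≤ a → Real.exp a - Real.exp b ≤ a - b := by
    intro a b ha hab
    have h1 : Real.exp b = Real.exp a * Real.exp (b - a) := by
      rw [← Real.exp_add]; ring_nf
    have h2 := Real.add_one_le_exp (b - a)
    have h3 := Real.exp_le_one_iff.2 ha
    nlinarith [Real.exp_pos a]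
  rcases le_total b a with h | h
  · rw [abs_of_nonneg (sub_nonneg.2 (Real.exp_le_exp.2 h)), abs_of_nonneg (sub_nonneg.2 h)]
    exact key a b ha h
  · rw [abs_sub_comm, abs_sub_comm a b,
      abs_of_nonneg (sub_nonneg.2 (Real.exp_le_exp.2 h)), abs_of_nonneg (sub_nonneg.2 h)]
    exact key b a hb h

/-- A singular second-order Gronwall inequality. -/
lemma abs_le_of_abs_deriv_le_integral {R ε : ℝ} (hε : 0 ≤ ε) {w w' : ℝ → ℝ}
    (hw : ContinuousOn w (Icc 0 R)) (hw0 : w 0 = 0)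
    (hd : ∀ r ∈ Ioc 0 R, HasDerivAt w (w' r) r)
    (hw' : ∀ r ∈ Ioc 0 R, |w' r| ≤ ∫ s in (0:ℝ)..r, (ε + |w s|)) :
    (∀ r ∈ Icc 0 R, |w r| ≤ ε * Real.exp R) ∧ ∀ r ∈ Ioc 0 R, |w' r| ≤ ε * Real.exp R := by
  rcases lt_or_ge R 0 with hR | hR
  · exact ⟨fun r hr => absurd (hr.1.trans hr.2) hR.not_ge,
      fun r hr => absurd (hr.1.le.trans hr.2) hR.not_ge⟩
  set k : ℝ → ℝ := fun s => ε + |IccExtend hR ((Icc 0 R).domRestrict w) s| with hk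
  have hkc : Continuous k :=
    continuous_const.add ((continuousOn_iff_continuous_domRestrict.1 hw).Icc_extend' (h := hR)).abs
  have hkw : ∀ s ∈ Icc 0 R, k s = ε + |w s| := fun s hs => by
    simp [hk, IccExtend_of_mem hR _ hs, Set.domRestrict]
  have hk0 : ∀ s, 0 ≤ k s := fun s => by positivity
  set X : ℝ → ℝ := fun r => ∫ s in (0:ℝ)..r, k s with hX
  have hXd : ∀ r, HasDerivAt X (k r) r := fun r => hkc.integral_hasStrictDerivAt 0 r |>.hasDerivAt
  have hXc : Continuous X := continuous_iff_continuousAt.2 fun r => (hXd r).continuousAt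
  set Y : ℝ → ℝ := fun r => ∫ s in (0:ℝ)..r, X s with hY
  have hYd : ∀ r, HasDerivAt Y (X r) r := fun r => hXc.integral_hasStrictDerivAt 0 r |>.hasDerivAt
  have hYc : Continuous Y := continuous_iff_continuousAt.2 fun r => (hYd r).continuousAt
  have hX0 : ∀ r, 0 ≤ r → 0 ≤ X r := fun r hr =>
    intervalIntegral.integral_nonneg hr fun s _ => hk0 s
  have hY0 : ∀ r, 0 ≤ r → 0 ≤ Y r := fun r hr =>
    intervalIntegral.integral_nonneg hr fun s hs => hX0 s hs.1
  have hw'X : ∀ r ∈ Ioc 0 R, |w' r| ≤ X r := fun r hr => by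
    refine (hw' r hr).trans_eq (intervalIntegral.integral_congr fun s hs => ?_)
    rw [uIcc_of_le hr.1.le] at hs
    exact (hkw s ⟨hs.1, hs.2.trans hr.2⟩).symm
  have hwY : ∀ r ∈ Icc 0 R, |w r| ≤ Y r := by
    intro r hr
    have m1 : MonotoneOn (fun r => Y r - w r) (Icc 0 R) := by
      refine monotoneOn_of_hasDerivWithinAt_nonneg (f' := fun r => X r - w' r) (convex_Icc _ _)
        (hYc.continuousOn.sub hw) ?_ ?_ <;> rw [interior_Icc]
      · exact fun x hx => ((hYd x).sub (hd x ⟨hx.1, hx.2.le⟩)).hasDerivWithinAt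
      · exact fun x hx => sub_nonneg.2 ((le_abs_self _).trans (hw'X x ⟨hx.1, hx.2.le⟩))
    have m2 : MonotoneOn (fun r => Y r + w r) (Icc 0 R) := by
      refine monotoneOn_of_hasDerivWithinAt_nonneg (f' := fun r => X r + w' r) (convex_Icc _ _)
        (hYc.continuousOn.add hw) ?_ ?_ <;> rw [interior_Icc]
      · exact fun x hx => ((hYd x).add (hd x ⟨hx.1, hx.2.le⟩)).hasDerivWithinAt
      · intro x hx
        have := (neg_abs_le (w' x))
        have := hw'X x ⟨hx.1, hx.2.le⟩
        linarith
    have e1 := m1 ⟨le_rfl, hR⟩ hr hr.1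
    have e2 := m2 ⟨le_rfl, hR⟩ hr hr.1
    have e3 : Y 0 = 0 := by simp [hY]
    simp only [hw0, e3] at e1 e2
    rw [abs_le]
    constructor <;> linarith
  have hS : ∀ r ∈ Icc 0 R, X r + Y r ≤ ε * Real.exp R := by
    intro r hr
    have m : AntitoneOn (fun r => Real.exp (-r) * (X r + Y r + ε)) (Icc 0 R) := by
      refine antitoneOn_of_hasDerivWithinAt_nonpos
        (f' := fun r => Real.exp (-r) * (k r + X r - (X r + Y r + ε))) (convex_Icc _ _)
        (by fun_prop) ?_ ?_ <;> rw [interior_Icc]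
      · intro x hx
        have e := ((hasDerivAt_id x).neg.exp).mul (((hXd x).add (hYd x)).add_const ε)
        refine (e.congr_deriv ?_).hasDerivWithinAt
        simp only [id, Pi.add_apply, Pi.neg_apply]
        ring
      · intro x hx
        have hx' : x ∈ Icc 0 R := ⟨hx.1.le, hx.2.le⟩
        have := hwY x hx'
        refine mul_nonpos_of_nonneg_of_nonpos (Real.exp_pos _).le ?_
        rw [hkw x hx']
        linarith
    have e1 := m ⟨le_rfl, hR⟩ hr hr.1
    have e3 : Y 0 = 0 := by simp [hY]
    have e4 : X 0 = 0 := by simp [hX]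
    simp only [e3, e4, neg_zero, Real.exp_zero] at e1
    have e5 : X r + Y r + ε ≤ ε * Real.exp r := by
      have := mul_le_mul_of_nonneg_left e1 (Real.exp_pos r).le
      rw [← mul_assoc, ← Real.exp_add] at this
      simpa [mul_comm] using this
    have e6 := mul_le_mul_of_nonneg_left (Real.exp_le_exp.2 hr.2) hε
    linarith
  refine ⟨fun r hr => (hwY r hr).trans ?_, fun r hr => (hw'X r hr).trans ?_⟩
  · linarith [hS r hr, hX0 r hr.1]
  · linarith [hS r ⟨hr.1.le, hr.2⟩, hY0 r hr.1.le]

section Nonlinearity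

variable {p : ℝ} {h f : ℝ → ℝ} {t₀ : ℝ}

lemma hasDerivAt_log_nonlinearity (hhC1 : ContDiffOn ℝ 1 h (Ici 0)) (ht₀ : 0 < t₀)
    (hhpos : ∀ t : ℝ, t₀ ≤ t → 0 < h t) (hf : ∀ t : ℝ, f t = h t * Real.exp (t ^ p))
    {t : ℝ} (ht : t₀ ≤ t) :
    HasDerivAt (fun t => Real.log (f t)) (t ^ (p - 1) * (p + deriv h t / (t ^ (p - 1) * h t))) t := by
  have ht0 : 0 < t := ht₀.trans_le ht
  have hht := hhpos t ht
  have h1 : HasDerivAt h (deriv h t) t :=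
    ((hhC1.contDiffAt (Ici_mem_nhds ht0)).differentiableAt one_ne_zero).hasDerivAt
  have h2 : HasDerivAt (fun t : ℝ => t ^ p) (p * t ^ (p - 1)) t :=
    Real.hasDerivAt_rpow_const (Or.inl ht0.ne')
  have h3 := (h1.mul h2.exp).log (mul_pos hht (Real.exp_pos _)).ne'
  have h4 : (fun t => Real.log (f t)) = fun t => Real.log ((h * fun t => Real.exp (t ^ p)) t) := by
    funext t; rw [hf]; rfl
  rw [h4]
  convert h3 using 1
  have := Real.rpow_pos_of_pos ht0 (p - 1)
  have := Real.exp_pos (t ^ p)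
  simp only [Pi.mul_apply]
  field_simp
  ring

lemma continuousOn_nonlinearity (hp : 0 < p) (hhC1 : ContDiffOn ℝ 1 h (Ici 0))
    (hf : ∀ t : ℝ, f t = h t * Real.exp (t ^ p)) : ContinuousOn f (Ici 0) := by
  have h1 : f = fun t => h t * Real.exp (t ^ p) := funext hf
  rw [h1]
  exact hhC1.continuousOn.mul (Real.continuous_rpow_const hp.le).rexp.continuousOn

lemma eventually_forall_le_nonlinearity (hp : 0 < p) (hhC1 : ContDiffOn ℝ 1 h (Ici 0)) (ht₀ : 0 < t₀)
    (hhpos : ∀ t : ℝ, t₀ ≤ t → 0 < h t) (hf : ∀ t : ℝ, f t = h t * Real.exp (t ^ p))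
    (H1 : Tendsto (fun t : ℝ => deriv h t / (t ^ (p - 1) * h t)) atTop (𝓝 0)) :
    ∀ᶠ m in atTop, ∀ t ∈ Icc 0 m, f t ≤ f m := by
  obtain ⟨T, hT⟩ := eventually_atTop.1 ((H1.eventually_const_lt
    (show -(p / 2) < 0 by linarith)).and (eventually_ge_atTop t₀))
  have hT0 : 0 < T := ht₀.trans_le (hT T le_rfl).2
  have hfpos : ∀ t, T ≤ t → 0 < f t := fun t ht => by
    rw [hf]; exact mul_pos (hhpos t (hT t ht).2) (Real.exp_pos _)
  have hm : MonotoneOn (fun t => Real.log (f t) - t ^ p / 2) (Ici T) := by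
    have hd : ∀ t ∈ Ici T, HasDerivAt (fun t => Real.log (f t) - t ^ p / 2)
        (t ^ (p - 1) * (p + deriv h t / (t ^ (p - 1) * h t)) - p * t ^ (p - 1) / 2) t := fun t ht =>
      (hasDerivAt_log_nonlinearity hhC1 ht₀ hhpos hf (hT t ht).2).sub
        ((Real.hasDerivAt_rpow_const (Or.inl (hT0.trans_le ht).ne')).div_const 2)
    refine monotoneOn_of_hasDerivWithinAt_nonneg (convex_Ici _)
      (fun t ht => (hd t ht).continuousAt.continuousWithinAt)
      (fun t ht => (hd t (interior_subset ht)).hasDerivWithinAt) fun t ht => ?_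
    have ht' : T ≤ t := interior_subset ht
    have := (hT t ht').1
    have := Real.rpow_pos_of_pos (hT0.trans_le ht') (p - 1)
    nlinarith
  have hmono : ∀ s t, T ≤ s → s ≤ t → f s ≤ f t := by
    intro s t hs hst
    have e := hm hs (hs.trans hst) hst
    have e2 := Real.rpow_le_rpow (hT0.trans_le hs).le hst hp.le
    simp only at e
    exact (Real.log_le_log_iff (hfpos s hs) (hfpos t (hs.trans hst))).1 (by linarith)
  have hlog : Tendsto (fun t => Real.log (f t)) atTop atTop := by
    have e : Tendsto (fun t : ℝ => Real.log (f T) - T ^ p / 2 + t ^ p / 2) atTop atTop :=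
      tendsto_atTop_add_const_left _ _ ((tendsto_rpow_atTop hp).atTop_div_const two_pos)
    refine tendsto_atTop_mono' _ ?_ e
    filter_upwards [eventually_ge_atTop T] with t ht
    have := hm (mem_Ici.2 le_rfl) ht ht
    simp only at this
    linarith
  obtain ⟨C, hC⟩ := isCompact_Icc.bddAbove_image
    ((continuousOn_nonlinearity hp hhC1 hf).mono (Icc_subset_Ici_self : Icc 0 T ⊆ Ici 0))
  filter_upwards [eventually_ge_atTop T, hlog.eventually_ge_atTop (Real.log (max C 1))]
    with m hmT hmC t ht
  rcases le_total t T with h | h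
  · have e1 : f t ≤ C := hC (mem_image_of_mem _ ⟨ht.1, h⟩)
    have e2 := (Real.log_le_log_iff (by positivity) (hfpos m hmT)).1 hmC
    exact e1.trans ((le_max_left _ _).trans e2)
  · exact hmono t m h ht.2

lemma eventually_abs_nonlinearity_div_sub_exp_le (hp : 0 < p) (hhC1 : ContDiffOn ℝ 1 h (Ici 0))
    (ht₀ : 0 < t₀) (hhpos : ∀ t : ℝ, t₀ ≤ t → 0 < h t)
    (hf : ∀ t : ℝ, f t = h t * Real.exp (t ^ p))
    (H1 : Tendsto (fun t : ℝ => deriv h t / (t ^ (p - 1) * h t)) atTop (𝓝 0))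
    {M ε : ℝ} (hM : 0 < M) (hε : 0 < ε) :
    ∀ᶠ m in atTop, ∀ t ≤ m, p * m ^ (p - 1) * (m - t) ≤ M →
      |f t / f m - Real.exp (p * m ^ (p - 1) * (t - m))| ≤ ε := by
  have hG : Tendsto (fun x : ℝ × ℝ => x.1 ^ (p - 1) * (1 + x.2 / p)) (𝓝 1 ×ˢ 𝓝 0) (𝓝 1) := by
    have h1 : Tendsto (fun s : ℝ => s ^ (p - 1)) (𝓝 1) (𝓝 1) := by
      simpa using (Real.continuousAt_rpow_const 1 (p - 1) (Or.inl one_ne_zero)).tendsto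
    have h2 : Tendsto (fun q : ℝ => 1 + q / p) (𝓝 0) (𝓝 1) := by
      simpa using ((tendsto_id (x := 𝓝 (0:ℝ))).div_const p).const_add 1
    simpa using (h1.comp tendsto_fst).mul (h2.comp tendsto_snd)
  have hG' := hG.eventually (Metric.closedBall_mem_nhds 1 (div_pos hε hM))
  obtain ⟨S, hS, Q, hQ, hSQ⟩ := eventually_prod_iff.1 hG'
  obtain ⟨η, hη, hηS⟩ := Metric.eventually_nhds_iff.1 hS
  obtain ⟨T, hT⟩ := eventually_atTop.1 ((H1.eventually hQ).and (eventually_ge_atTop t₀))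
  have hT0 : 0 < T := ht₀.trans_le (hT T le_rfl).2
  have hsmall : Tendsto (fun m : ℝ => M / (p * m ^ p)) atTop (𝓝 0) :=
    ((tendsto_rpow_atTop hp).const_mul_atTop hp).const_div_atTop M
  filter_upwards [eventually_forall_le_nonlinearity hp hhC1 ht₀ hhpos hf H1,
    eventually_gt_atTop (2 * T), hsmall.eventually_lt_const hη,
    hsmall.eventually_lt_const (show (0:ℝ) < 1 / 2 by norm_num)] with m hmax hmT hm1 hm2 t htm ht
  have hm0 : 0 < m := by linarith
  have hmp := Real.rpow_pos_of_pos hm0 (p - 1)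
  have hmpe : m ^ p = m ^ (p - 1) * m := by
    rw [← Real.rpow_add_one hm0.ne']; ring_nf
  have hrel : (m - t) / m ≤ M / (p * m ^ p) := by
    rw [hmpe, div_le_div_iff₀ hm0 (by positivity)]
    nlinarith
  have htT : T < t := by
    have := hrel.trans_lt hm2
    rw [div_lt_iff₀ hm0] at this
    linarith
  have hfpos : ∀ t, T ≤ t → 0 < f t := fun t ht => by
    rw [hf]; exact mul_pos (hhpos t (hT t ht).2) (Real.exp_pos _)
  have hft := hfpos t htT.le
  have hfm := hfpos m (htT.le.trans htm)
  have hlogle : Real.log (f t / f m) ≤ 0 :=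
    Real.log_nonpos (by positivity) ((div_le_one hfm).2 (hmax t ⟨(hT0.trans htT).le, htm⟩))
  have hz : p * m ^ (p - 1) * (t - m) ≤ 0 :=
    mul_nonpos_of_nonneg_of_nonpos (by positivity) (by linarith)
  rw [← Real.exp_log (div_pos hft hfm)]
  refine (abs_exp_sub_exp_le hlogle hz).trans ?_
  rcases htm.eq_or_lt with rfl | hlt
  · simp [hft.ne', hε.le]
  have hd : ∀ x ∈ Icc t m, HasDerivAt (fun t => Real.log (f t))
      (x ^ (p - 1) * (p + deriv h x / (x ^ (p - 1) * h x))) x := fun x hx =>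
    hasDerivAt_log_nonlinearity hhC1 ht₀ hhpos hf (hT x (htT.le.trans hx.1)).2
  obtain ⟨x, hx, hxe⟩ := exists_hasDerivAt_eq_slope _ _ hlt
    (fun x hx => (hd x hx).continuousAt.continuousWithinAt) (fun x hx => hd x ⟨hx.1.le, hx.2.le⟩)
  have hx0 : 0 < x := hT0.trans (htT.trans hx.1)
  have hxS : dist (x / m) 1 < η := by
    rw [Real.dist_eq, abs_sub_comm, abs_of_nonneg (sub_nonneg.2 ((div_le_one hm0).2 hx.2.le))]
    refine lt_of_le_of_lt ?_ (hrel.trans_lt hm1)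
    rw [le_div_iff₀ hm0]
    field_simp
    linarith [hx.1]
  have hball := hSQ (hηS hxS) (hT x (htT.le.trans hx.1.le)).1
  simp only [Real.dist_eq] at hball
  rw [eq_div_iff (sub_pos.2 hlt).ne'] at hxe
  set q := deriv h x / (x ^ (p - 1) * h x)
  have hid : Real.log (f t / f m) - p * m ^ (p - 1) * (t - m)
      = -((x / m) ^ (p - 1) * (1 + q / p) - 1) * (p * m ^ (p - 1) * (m - t)) := by
    rw [Real.log_div hft.ne' hfm.ne', Real.div_rpow hx0.le hm0.le]
    have : Real.log (f t) - Real.log (f m) = -(x ^ (p - 1) * (p + q) * (m - t)) := by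
      rw [hxe]; ring
    rw [this]
    field_simp
    ring
  rw [hid, abs_mul, abs_neg]
  have hnn : 0 ≤ p * m ^ (p - 1) * (m - t) := mul_nonneg (by positivity) (by linarith)
  rw [abs_of_nonneg hnn]
  calc _ ≤ ε / M * M := mul_le_mul hball ht hnn (by positivity)
    _ = ε := by field_simp

end Nonlinearity

lemma abs_sub_z0_le {R δ : ℝ} (hδ : 0 ≤ δ) {z z' F : ℝ → ℝ}
    (hz : ContinuousOn z (Icc 0 R)) (hz0 : z 0 = 0) (hzneg : ∀ r ∈ Icc 0 R, z r ≤ 0)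
    (hF : ContinuousOn F (Icc 0 R)) (hd : ∀ r ∈ Ioc 0 R, HasDerivAt z (z' r) r)
    (hz' : ∀ r ∈ Ioc 0 R, r * z' r = -∫ s in (0:ℝ)..r, s * F s)
    (hFz : ∀ r ∈ Icc 0 R, |F r - Real.exp (z r)| ≤ δ) :
    (∀ r ∈ Icc 0 R, |z r - z0 r| ≤ δ * Real.exp R) ∧
      ∀ r ∈ Ioc 0 R, |z' r - deriv z0 r| ≤ δ * Real.exp R := by
  refine abs_le_of_abs_deriv_le_integral hδ (hz.sub continuous_z0.continuousOn)
    (by rw [hz0, z0_zero, sub_zero])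
    (fun r hr => (hd r hr).sub (hasDerivAt_z0 r).differentiableAt.hasDerivAt) fun r hr => ?_
  have hsub : Icc 0 r ⊆ Icc 0 R := Icc_subset_Icc_right hr.2
  have hFi : IntervalIntegrable (fun s => s * F s) MeasureTheory.volume 0 r :=
    ContinuousOn.intervalIntegrable_of_Icc hr.1.le (continuousOn_id.mul (hF.mono hsub))
  have hEi : IntervalIntegrable (fun s => s * Real.exp (z0 s)) MeasureTheory.volume 0 r :=
    (continuous_id.mul continuous_z0.rexp).intervalIntegrable 0 r
  have hwi : IntervalIntegrable (fun s => δ + |z s - z0 s|) MeasureTheory.volume 0 r :=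
    ContinuousOn.intervalIntegrable_of_Icc hr.1.le
      (continuousOn_const.add ((hz.mono hsub).sub continuous_z0.continuousOn).abs)
  have he : r * (z' r - deriv z0 r) = -∫ s in (0:ℝ)..r, (s * F s - s * Real.exp (z0 s)) := by
    rw [intervalIntegral.integral_sub hFi hEi, integral_mass_z0, mul_sub, hz' r hr, deriv_z0]
    ring
  have hle : ‖∫ s in (0:ℝ)..r, (s * F s - s * Real.exp (z0 s))‖
      ≤ ∫ s in (0:ℝ)..r, r * (δ + |z s - z0 s|) := by
    refine intervalIntegral.norm_integral_le_of_norm_le hr.1.le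
      (Eventually.of_forall fun s hs => ?_) (hwi.const_mul r)
    have hsR : s ∈ Icc 0 R := ⟨hs.1.le, hs.2.trans hr.2⟩
    rw [← mul_sub, Real.norm_eq_abs, abs_mul, abs_of_pos hs.1]
    refine mul_le_mul hs.2 ?_ (abs_nonneg _) hr.1.le
    calc |F s - Real.exp (z0 s)| ≤ |F s - Real.exp (z s)| + |Real.exp (z s) - Real.exp (z0 s)| :=
          abs_sub_le _ _ _
      _ ≤ _ := add_le_add (hFz s hsR) (abs_exp_sub_exp_le (hzneg s hsR) (z0_nonpos s))
  rw [intervalIntegral.integral_const_mul, Real.norm_eq_abs, ← abs_neg, ← he, abs_mul,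
    abs_of_pos hr.1] at hle
  exact le_of_mul_le_mul_left hle hr.1

section Radial

variable {u g : ℝ → ℝ}

lemma hasDerivAt_of_contDiffOn_Icc (hu : ContDiffOn ℝ 2 u (Icc 0 1)) {r : ℝ}
    (hr : r ∈ Ioo (0:ℝ) 1) : HasDerivAt u (deriv u r) r :=
  ((hu.contDiffAt (Icc_mem_nhds hr.1 hr.2)).differentiableAt two_ne_zero).hasDerivAt

lemma mul_deriv_eq_neg_integral (hu : ContDiffOn ℝ 2 u (Icc 0 1))
    (hg : ContinuousOn g (Icc 0 1))
    (hode : ∀ r ∈ Ioo (0:ℝ) 1, -(deriv (deriv u) r) - deriv u r / r = g r) {r : ℝ}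
    (hr : r ∈ Ioo (0:ℝ) 1) : r * deriv u r = -∫ s in (0:ℝ)..r, s * g s := by
  have hD : ∀ s ∈ Ioo (0:ℝ) 1, derivWithin u (Icc 0 1) s = deriv u s := fun s hs =>
    derivWithin_of_mem_nhds (Icc_mem_nhds hs.1 hs.2)
  have hDc := hu.continuousOn_derivWithin (uniqueDiffOn_Icc zero_lt_one) (by norm_num)
  have hd2 : ∀ s ∈ Ioo (0:ℝ) 1, HasDerivAt (deriv u) (deriv (deriv u) s) s := fun s hs =>
    ((((hu.mono Ioo_subset_Icc_self).deriv_of_isOpen isOpen_Ioo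
      (show (1:WithTop ℕ∞) + 1 ≤ 2 by norm_num)).contDiffAt
        (isOpen_Ioo.mem_nhds hs)).differentiableAt one_ne_zero).hasDerivAt
  have hsub : Icc 0 r ⊆ Icc 0 1 := Icc_subset_Icc_right hr.2.le
  have key := intervalIntegral.integral_eq_sub_of_hasDerivAt_of_le
    (f := fun s => s * derivWithin u (Icc 0 1) s) (f' := fun s => -(s * g s)) hr.1.le
    (continuousOn_id.mul (hDc.mono hsub)) (fun s hs => ?_)
    (ContinuousOn.intervalIntegrable_of_Icc hr.1.le (continuousOn_id.mul (hg.mono hsub)).neg)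
  · rw [intervalIntegral.integral_neg, hD r hr] at key
    linarith
  · have hs1 : s ∈ Ioo (0:ℝ) 1 := ⟨hs.1, hs.2.trans hr.2⟩
    have e := (hasDerivAt_id s).mul (hd2 s hs1)
    have e2 : HasDerivAt (fun s => s * derivWithin u (Icc 0 1) s) _ s :=
      e.congr_of_eventuallyEq (by
        filter_upwards [isOpen_Ioo.mem_nhds hs1] with x hx
        simp [hD x hx])
    refine e2.congr_deriv ?_
    have := hode s hs1
    have hs0 := hs.1.ne'
    simp only [id]
    field_simp at this
    linarith

lemma radial_bounds {f : ℝ → ℝ} {lam m : ℝ} (hlam : 0 < lam) (hu : ContDiffOn ℝ 2 u (Icc 0 1))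
    (hf : ContinuousOn f (Ici 0)) (hf0 : ∀ t, 0 ≤ t → 0 ≤ f t) (hfm : ∀ t ∈ Icc 0 m, f t ≤ f m)
    (hu0 : u 0 = m) (hunonneg : ∀ r ∈ Icc (0:ℝ) 1, 0 ≤ u r)
    (hode : ∀ r ∈ Ioo (0:ℝ) 1, -(deriv (deriv u) r) - deriv u r / r = lam * f (u r))
    {r : ℝ} (hr : r ∈ Icc (0:ℝ) 1) : u r ≤ m ∧ m - lam * f m * r ^ 2 / 4 ≤ u r := by
  have hg : ContinuousOn (fun r => lam * f (u r)) (Icc 0 1) :=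
    continuousOn_const.mul (hf.comp hu.continuousOn hunonneg)
  have h0 : (0:ℝ) ∈ Icc (0:ℝ) 1 := ⟨le_rfl, zero_le_one⟩
  have hgi : ∀ r ∈ Icc (0:ℝ) 1, IntervalIntegrable (fun s => s * (lam * f (u s)))
      MeasureTheory.volume 0 r := fun r hr =>
    ContinuousOn.intervalIntegrable_of_Icc hr.1
      (continuousOn_id.mul (hg.mono (Icc_subset_Icc_right hr.2)))
  have hanti : AntitoneOn u (Icc 0 1) := by
    refine antitoneOn_of_hasDerivWithinAt_nonpos (f' := deriv u) (convex_Icc _ _)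
      hu.continuousOn ?_ ?_ <;> rw [interior_Icc]
    · exact fun x hx => (hasDerivAt_of_contDiffOn_Icc hu hx).hasDerivWithinAt
    · intro x hx
      have e := mul_deriv_eq_neg_integral hu hg hode hx
      have e2 : 0 ≤ ∫ s in (0:ℝ)..x, s * (lam * f (u s)) :=
        intervalIntegral.integral_nonneg hx.1.le fun s hs =>
          mul_nonneg hs.1 (mul_nonneg hlam.le (hf0 _ (hunonneg s ⟨hs.1, hs.2.trans hx.2.le⟩)))
      by_contra! hlt
      have := mul_pos hx.1 hlt
      linarith
  have hum : ∀ r ∈ Icc (0:ℝ) 1, u r ≤ m := fun r hr => hu0 ▸ hanti h0 hr hr.1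
  have hmono : MonotoneOn (fun r => u r + lam * f m * r ^ 2 / 4) (Icc 0 1) := by
    refine monotoneOn_of_hasDerivWithinAt_nonneg
      (f' := fun r => deriv u r + lam * f m * r / 2) (convex_Icc _ _)
      (hu.continuousOn.add (by fun_prop)) ?_ ?_ <;> rw [interior_Icc]
    · intro x hx
      have e := (hasDerivAt_of_contDiffOn_Icc hu hx).add
        (((hasDerivAt_pow 2 x).const_mul (lam * f m)).div_const 4)
      refine (e.congr_deriv ?_).hasDerivWithinAt
      norm_num
      ring
    · intro x hx
      have e := mul_deriv_eq_neg_integral hu hg hode hx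
      have e2 : ∫ s in (0:ℝ)..x, s * (lam * f (u s)) ≤ ∫ s in (0:ℝ)..x, s * (lam * f m) := by
        refine intervalIntegral.integral_mono_on hx.1.le (hgi x ⟨hx.1.le, hx.2.le⟩)
          ((continuous_id.mul continuous_const).intervalIntegrable 0 x) fun s hs => ?_
        have hs1 : s ∈ Icc (0:ℝ) 1 := ⟨hs.1, hs.2.trans hx.2.le⟩
        exact mul_le_mul_of_nonneg_left (mul_le_mul_of_nonneg_left
          (hfm _ ⟨hunonneg s hs1, hum s hs1⟩) hlam.le) hs.1
      rw [intervalIntegral.integral_mul_const, integral_id] at e2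
      by_contra! hlt
      have := mul_neg_of_pos_of_neg hx.1 hlt
      nlinarith
  refine ⟨hum r hr, ?_⟩
  have := hmono h0 hr hr.1
  simp only [hu0] at this
  linarith

/-- The rescaled first-order identity around the origin. -/
lemma mul_deriv_rescaled {f z : ℝ → ℝ} {lam c γ K : ℝ} (hK : K ≠ 0)
    (hu : ContDiffOn ℝ 2 u (Icc 0 1)) (hg : ContinuousOn (fun r => lam * f (u r)) (Icc 0 1))
    (hode : ∀ r ∈ Ioo (0:ℝ) 1, -(deriv (deriv u) r) - deriv u r / r = lam * f (u r))
    (hscale : c * lam * K * γ ^ 2 = 1) {m : ℝ} (hz : ∀ r, z r = c * (u (γ * r) - m)) {r : ℝ}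
    (hr : γ * r ∈ Ioo (0:ℝ) 1) :
    HasDerivAt z (c * (γ * deriv u (γ * r))) r ∧
      r * (c * (γ * deriv u (γ * r))) = -∫ s in (0:ℝ)..r, s * (f (u (γ * s)) / K) := by
  constructor
  · have hz' : z = fun r => c * (u (γ * r) - m) := funext hz
    rw [hz']
    have e := (hasDerivAt_of_contDiffOn_Icc hu hr).comp r ((hasDerivAt_id r).const_mul γ)
    refine ((e.sub_const m).const_mul c).congr_deriv ?_
    ring
  · have e := mul_deriv_eq_neg_integral hu hg hode hr
    have e2 := intervalIntegral.smul_integral_comp_mul_left (a := 0) (b := r)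
      (fun x => x * (lam * f (u x))) γ
    rw [mul_zero, smul_eq_mul] at e2
    have e3 : ∫ s in (0:ℝ)..r, s * (f (u (γ * s)) / K)
        = c * γ * ∫ s in (0:ℝ)..r, γ * s * (lam * f (u (γ * s))) := by
      rw [← intervalIntegral.integral_const_mul]
      refine intervalIntegral.integral_congr fun s _ => ?_
      have : c * lam * γ ^ 2 = 1 / K := by
        field_simp
        linarith
      calc s * (f (u (γ * s)) / K) = 1 / K * (s * f (u (γ * s))) := by ring
        _ = _ := by rw [← this]; ring
    rw [e3, mul_assoc c, e2, ← neg_eq_iff_eq_neg.2 e]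
    ring

end Radial

/-- Theorem 1.1 of the paper, first concentration. -/
theorem statement4
    (p : ℝ) (hp : 0 < p)
    (h : ℝ → ℝ)
    (hhC1 : ContDiffOn ℝ 1 h (Set.Ici 0))
    (hhnonneg : ∀ t : ℝ, 0 ≤ t → 0 ≤ h t)
    (t₀ : ℝ) (ht₀ : 0 < t₀) (hhpos : ∀ t : ℝ, t₀ ≤ t → 0 < h t)
    (f : ℝ → ℝ) (hf : ∀ t : ℝ, f t = h t * Real.exp (t ^ p))
    (H1 : Tendsto (fun t : ℝ => deriv h t / (t ^ (p - 1) * h t)) atTop (nhds 0))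
    (lam μ : ℕ → ℝ) (u : ℕ → ℝ → ℝ)
    (hlam : ∀ n, 0 < lam n) (hμ : ∀ n, 0 < μ n)
    (huC2 : ∀ n, ContDiffOn ℝ 2 (u n) (Set.Icc 0 1))
    (hupos : ∀ n, ∀ r ∈ Set.Ico (0:ℝ) 1, 0 < u n r)
    (hu0 : ∀ n, u n 0 = μ n)
    (hu'0 : ∀ n, deriv (u n) 0 = 0)
    (hu1 : ∀ n, u n 1 = 0)
    (heq : ∀ n, ∀ r ∈ Set.Ioo (0:ℝ) 1,
      -(deriv (deriv (u n)) r) - deriv (u n) r / r = lam n * f (u n r))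
    (hmuInf : Tendsto μ atTop atTop)
    (γ : ℕ → ℝ) (hγpos : ∀ n, 0 < γ n)
    (hγ : ∀ n, p * lam n * μ n ^ (p - 1) * f (μ n) * (γ n) ^ 2 = 1)
    (z : ℕ → ℝ → ℝ)
    (hz : ∀ n r, z n r = p * μ n ^ (p - 1) * (u n (γ n * r) - μ n)) :
    -- properties of the limit profile z₀
    z0 0 = 0 ∧ deriv z0 0 = 0 ∧
    (∀ r ∈ Set.Ioi (0:ℝ),
      -(deriv (deriv z0) r) - deriv z0 r / r = Real.exp (z0 r)) ∧
    (∫ r in Set.Ioi (0:ℝ), Real.exp (z0 r) * r) = 4 ∧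
    -- the concentration statement, up to a subsequence
    (∃ φ : ℕ → ℕ, StrictMono φ ∧ ∃ ρ : ℕ → ℝ,
      (∀ n, ρ n ∈ Set.Ioo (0:ℝ) 1) ∧
      Tendsto (fun n => γ (φ n)) atTop (nhds 0) ∧
      Tendsto ρ atTop (nhds 0) ∧
      Tendsto (fun n => ρ n / γ (φ n)) atTop atTop ∧
      Tendsto (fun n => u (φ n) (ρ n) / μ (φ n)) atTop (nhds 1) ∧
      (∀ ε : ℝ, 0 < ε → ∀ᶠ n in atTop,
        ∀ r ∈ Set.Icc (0:ℝ) (ρ n / γ (φ n)),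
          |z (φ n) r - z0 r| ≤ ε ∧ |deriv (z (φ n)) r - deriv z0 r| ≤ ε) ∧
      Tendsto (fun n =>
          p * μ (φ n) ^ (p - 1) *
            ∫ x in (0:ℝ)..(ρ n), lam (φ n) * f (u (φ n) x) * x)
        atTop (nhds 4) ∧
      ∃ r₀ : ℕ → ℝ,
        (∀ n, r₀ n ∈ Set.Ioo 0 (ρ n)) ∧
        Tendsto (fun n => r₀ n / γ (φ n)) atTop (nhds (2 * Real.sqrt 2)) ∧
        Tendsto (fun n => u (φ n) (r₀ n) / μ (φ n)) atTop (nhds 1) ∧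
        Tendsto (fun n =>
            p * lam (φ n) * (r₀ n) ^ 2 * (u (φ n) (r₀ n)) ^ (p - 1) *
              f (u (φ n) (r₀ n)))
          atTop (nhds 2)) := by
  have hfc := continuousOn_nonlinearity hp hhC1 hf
  have hf0 : ∀ t, 0 ≤ t → 0 ≤ f t := fun t ht => by
    rw [hf]; exact mul_nonneg (hhnonneg t ht) (Real.exp_pos _).le
  have hfμ : ∀ n, 0 < f (μ n) := fun n =>
    (hf0 _ (hμ n).le).lt_of_ne' fun h0 => by simpa [h0] using hγ n
  have hunn : ∀ n, ∀ r ∈ Icc (0:ℝ) 1, 0 ≤ u n r := fun n r hr => by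
    rcases hr.2.eq_or_lt with rfl | h1
    · exact (hu1 n).ge
    · exact (hupos n r ⟨hr.1, h1⟩).le
  have hg : ∀ n, ContinuousOn (fun r => lam n * f (u n r)) (Icc 0 1) := fun n =>
    continuousOn_const.mul (hfc.comp (huC2 n).continuousOn (hunn n))
  have hscale : ∀ n, p * μ n ^ (p - 1) * lam n * f (μ n) * γ n ^ 2 = 1 := fun n => by
    linear_combination hγ n
  have hc : ∀ n, 0 < p * μ n ^ (p - 1) := fun n => mul_pos hp (Real.rpow_pos_of_pos (hμ n) _)
  have hμp : ∀ n, μ n ^ (p - 1) * μ n = μ n ^ p := fun n => by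
    rw [← Real.rpow_add_one (hμ n).ne']; ring_nf
  have hμpInf : Tendsto (fun n => p * μ n ^ p) atTop atTop :=
    ((tendsto_rpow_atTop hp).comp hmuInf).const_mul_atTop hp
  have hz0' : ∀ n, z n 0 = 0 := fun n => by simp [hz, hu0]
  have hdz0 : ∀ n, deriv (z n) 0 = 0 := fun n => by
    have e : z n = fun r => p * μ n ^ (p - 1) * ((fun r => u n (γ n * r)) r - μ n) := funext (hz n)
    rw [e, deriv_const_mul_field, deriv_sub_const, deriv_comp_mul_left, mul_zero, hu'0]
    simp
  have hzb : ∀ᶠ n in atTop, ∀ r, 0 ≤ r → γ n * r ≤ 1 → z n r ≤ 0 ∧ -(r ^ 2 / 4) ≤ z n r := by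
    filter_upwards [hmuInf.eventually
      (eventually_forall_le_nonlinearity hp hhC1 ht₀ hhpos hf H1)] with n hn r hr hr1
    obtain ⟨e1, e2⟩ := radial_bounds (hlam n) (huC2 n) hfc hf0 hn (hu0 n) (hunn n) (heq n)
      ⟨mul_nonneg (hγpos n).le hr, hr1⟩
    rw [hz]
    refine ⟨mul_nonpos_of_nonneg_of_nonpos (hc n).le (by linarith), ?_⟩
    calc -(r ^ 2 / 4) = p * μ n ^ (p - 1) * (-(lam n * f (μ n) * (γ n * r) ^ 2 / 4)) := by
          linear_combination r ^ 2 / 4 * hscale n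
      _ ≤ _ := mul_le_mul_of_nonneg_left (by linarith) (hc n).le
  have hγR : ∀ R : ℝ, 0 < R → ∀ᶠ n in atTop, γ n * R < 1 := by
    intro R hR
    filter_upwards [hzb, hμpInf.eventually_gt_atTop (R ^ 2 / 4)] with n hn hn2
    by_contra! hlt
    have e0 : γ n * (1 / γ n) = 1 := mul_one_div_cancel (hγpos n).ne'
    have e1 : 1 / γ n ≤ R := by rwa [div_le_iff₀ (hγpos n), mul_comm]
    have e3 : 0 ≤ 1 / γ n := (one_div_pos.2 (hγpos n)).le
    have e2 := (hn (1 / γ n) e3 e0.le).2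
    rw [hz, e0, hu1] at e2
    have e4 : p * μ n ^ (p - 1) * (0 - μ n) = -(p * μ n ^ p) := by rw [← hμp]; ring
    rw [e4] at e2
    nlinarith
  have hγ0 : Tendsto γ atTop (𝓝 0) := by
    refine (tendsto_order.2 ⟨fun a ha => Eventually.of_forall fun n => ha.trans (hγpos n),
      fun a ha => ?_⟩)
    filter_upwards [hγR (1 / a) (one_div_pos.2 ha)] with n hn
    rwa [mul_one_div, div_lt_one ha] at hn
  have hresc : ∀ n r, 0 < r → γ n * r < 1 →
      HasDerivAt (z n) (deriv (z n) r) r ∧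
        r * deriv (z n) r = -∫ s in (0:ℝ)..r, s * (f (u n (γ n * s)) / f (μ n)) := by
    intro n r hr hr1
    obtain ⟨e1, e2⟩ := mul_deriv_rescaled (hfμ n).ne' (huC2 n) (hg n) (heq n) (hscale n) (hz n)
      ⟨mul_pos (hγpos n) hr, hr1⟩
    rw [e1.deriv]
    exact ⟨e1, e2⟩
  have hratioF : ∀ R δ : ℝ, 0 < R → 0 < δ → ∀ᶠ n in atTop, ∀ r ∈ Icc 0 R,
      |f (u n (γ n * r)) / f (μ n) - Real.exp (z n r)| ≤ δ := by
    intro R δ hR hδ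
    filter_upwards [hzb, hγR R hR, hmuInf.eventually (eventually_abs_nonlinearity_div_sub_exp_le
      hp hhC1 ht₀ hhpos hf H1 (show 0 < R ^ 2 / 4 by positivity) hδ)] with n hn hn2 hn3 r hr
    obtain ⟨e1, e2⟩ := hn r hr.1 ((mul_le_mul_of_nonneg_left hr.2 (hγpos n).le).trans hn2.le)
    have e4 : r ^ 2 ≤ R ^ 2 := pow_le_pow_left₀ hr.1 hr.2 2
    rw [hz] at e1 e2 ⊢
    refine hn3 _ ?_ (by linarith)
    by_contra! hlt
    have := mul_pos (hc n) (sub_pos.2 hlt)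
    linarith
  have hconv : ∀ R δ : ℝ, 0 < R → 0 < δ → ∀ᶠ n in atTop, ∀ r ∈ Icc 0 R,
      |z n r - z0 r| ≤ δ ∧ |deriv (z n) r - deriv z0 r| ≤ δ := by
    intro R δ hR hδ
    filter_upwards [hzb, hγR R hR, hratioF R (δ * Real.exp (-R)) hR (by positivity)]
      with n hn hn2 hn3
    have hmem : ∀ r ∈ Icc 0 R, γ n * r ∈ Icc (0:ℝ) 1 := fun r hr =>
      ⟨mul_nonneg (hγpos n).le hr.1, (mul_le_mul_of_nonneg_left hr.2 (hγpos n).le).trans hn2.le⟩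
    have hlt : ∀ r ∈ Ioc 0 R, γ n * r < 1 := fun r hr =>
      (mul_le_mul_of_nonneg_left hr.2 (hγpos n).le).trans_lt hn2
    have huc : ContinuousOn (fun r => u n (γ n * r)) (Icc 0 R) :=
      (huC2 n).continuousOn.comp (by fun_prop) hmem
    have hzc : ContinuousOn (z n) (Icc 0 R) := by
      rw [show z n = fun r => p * μ n ^ (p - 1) * (u n (γ n * r) - μ n) from funext (hz n)]
      exact continuousOn_const.mul (huc.sub continuousOn_const)
    have hFc : ContinuousOn (fun r => f (u n (γ n * r)) / f (μ n)) (Icc 0 R) :=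
      (hfc.comp huc fun r hr => hunn n _ (hmem r hr)).div_const _
    obtain ⟨e1, e2⟩ := abs_sub_z0_le (by positivity) hzc (hz0' n)
      (fun r hr => (hn r hr.1 (hmem r hr).2).1) hFc (fun r hr => (hresc n r hr.1 (hlt r hr)).1)
      (fun r hr => (hresc n r hr.1 (hlt r hr)).2) hn3
    have e3 : δ * Real.exp (-R) * Real.exp R = δ := by
      rw [mul_assoc, ← Real.exp_add]; simp
    rw [e3] at e1 e2
    intro r hr
    refine ⟨e1 r hr, ?_⟩
    rcases hr.1.eq_or_lt with rfl | h0
    · simpa [hdz0, deriv_z0] using hδ.le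
    · exact e2 r ⟨h0, hr.2⟩
  have hheight : ∀ R : ℝ, 0 < R → Tendsto (fun n => u n (γ n * R) / μ n) atTop (𝓝 1) := by
    intro R hR
    have e : Tendsto (fun n => 1 - R ^ 2 / 4 / (p * μ n ^ p)) atTop (𝓝 1) := by
      simpa using (hμpInf.const_div_atTop (R ^ 2 / 4)).const_sub 1
    have key : ∀ n, u n (γ n * R) / μ n = 1 + z n R / (p * μ n ^ p) := fun n => by
      have h1 := hμ n
      have h2 := Real.rpow_pos_of_pos h1 (p - 1)
      rw [hz, ← hμp]
      field_simp
      ring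
    refine tendsto_of_tendsto_of_tendsto_of_le_of_le' e tendsto_const_nhds ?_ ?_
    · filter_upwards [hzb, hγR R hR] with n hn hn2
      have h1 : 0 < p * μ n ^ p := mul_pos hp (Real.rpow_pos_of_pos (hμ n) _)
      have := div_le_div_of_nonneg_right (hn R hR.le hn2.le).2 h1.le
      rw [neg_div] at this
      rw [key]
      linarith
    · filter_upwards [hzb, hγR R hR] with n hn hn2
      have h1 : 0 < p * μ n ^ p := mul_pos hp (Real.rpow_pos_of_pos (hμ n) _)
      have := div_nonpos_of_nonpos_of_nonneg (hn R hR.le hn2.le).1 h1.le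
      rw [key]
      linarith
  have hmass : ∀ n R, 0 < R → γ n * R < 1 →
      p * μ n ^ (p - 1) * ∫ x in (0:ℝ)..(γ n * R), lam n * f (u n x) * x
        = -(R * deriv (z n) R) := by
    intro n R hR hR1
    have hmem : γ n * R ∈ Ioo (0:ℝ) 1 := ⟨mul_pos (hγpos n) hR, hR1⟩
    have e1 := mul_deriv_eq_neg_integral (huC2 n) (hg n) (heq n) hmem
    have e2 := (mul_deriv_rescaled (hfμ n).ne' (huC2 n) (hg n) (heq n) (hscale n) (hz n) hmem).1
    have e3 : ∫ x in (0:ℝ)..(γ n * R), lam n * f (u n x) * x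
        = ∫ x in (0:ℝ)..(γ n * R), x * (lam n * f (u n x)) :=
      intervalIntegral.integral_congr fun x _ => mul_comm _ _
    rw [e2.deriv, e3, ← neg_eq_iff_eq_neg.2 e1]
    ring
  have hinner : Tendsto (fun n => f (u n (γ n * (2 * √2))) / f (μ n)) atTop (𝓝 (1 / 4)) := by
    have hR : 0 < 2 * √2 := by positivity
    have hmem : 2 * √2 ∈ Icc 0 (2 * √2) := ⟨hR.le, le_rfl⟩
    have e1 : Tendsto (fun n => z n (2 * √2)) atTop (𝓝 (z0 (2 * √2))) := by
      refine Metric.tendsto_nhds.2 fun ε hε => ?_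
      filter_upwards [hconv _ (ε / 2) hR (half_pos hε)] with n hn
      exact ((hn _ hmem).1).trans_lt (half_lt_self hε)
    have e2 : Tendsto (fun n => f (u n (γ n * (2 * √2))) / f (μ n) - Real.exp (z n (2 * √2)))
        atTop (𝓝 0) := by
      refine Metric.tendsto_nhds.2 fun ε hε => ?_
      filter_upwards [hratioF _ (ε / 2) hR (half_pos hε)] with n hn
      rw [Real.dist_eq, sub_zero]
      exact (hn _ hmem).trans_lt (half_lt_self hε)
    have e3 := e2.add (Real.continuous_exp.continuousAt.tendsto.comp e1)
    have e4 : Real.exp (z0 (2 * √2)) = 1 / 4 := by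
      rw [exp_z0, mul_pow, Real.sq_sqrt zero_le_two]; norm_num
    rw [zero_add, e4] at e3
    exact e3.congr fun n => by simp
  obtain ⟨φ, hφ, hφP⟩ := extraction_forall_of_eventually
    (P := fun k n => γ n * ((k:ℝ) + 3) ^ 2 < 1 ∧
      |u n (γ n * ((k:ℝ) + 3)) / μ n - 1| ≤ 1 / ((k:ℝ) + 3) ∧
      ∀ r ∈ Icc 0 ((k:ℝ) + 3), |z n r - z0 r| ≤ 1 / ((k:ℝ) + 3) ^ 2 ∧
        |deriv (z n) r - deriv z0 r| ≤ 1 / ((k:ℝ) + 3) ^ 2) fun k => by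
    have hk : (0:ℝ) < (k:ℝ) + 3 := by positivity
    exact ((hγR _ (by positivity)).and (((hheight _ hk).eventually
      (Metric.closedBall_mem_nhds 1 (one_div_pos.2 hk))).and
        (hconv _ _ hk (by positivity))))
  have hk : ∀ k : ℕ, (3:ℝ) ≤ (k:ℝ) + 3 := fun k => by linarith [Nat.cast_nonneg (α := ℝ) k]
  have hkInf : Tendsto (fun k : ℕ => (k:ℝ) + 3) atTop atTop :=
    tendsto_atTop_add_const_right _ _ tendsto_natCast_atTop_atTop
  have hkinv : Tendsto (fun k : ℕ => 1 / ((k:ℝ) + 3)) atTop (𝓝 0) := hkInf.const_div_atTop 1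
  have hρlt : ∀ k, γ (φ k) * ((k:ℝ) + 3) < 1 / ((k:ℝ) + 3) := fun k => by
    rw [lt_div_iff₀ (by linarith [hk k])]
    have := (hφP k).1
    linarith
  have hρ1 : ∀ k, γ (φ k) * ((k:ℝ) + 3) < 1 := fun k =>
    (hρlt k).trans_le ((div_le_one (by linarith [hk k])).2 (by linarith [hk k]))
  have hρ0 : ∀ k, 0 < γ (φ k) * ((k:ℝ) + 3) := fun k =>
    mul_pos (hγpos _) (by linarith [hk k])
  have hργ : ∀ k, γ (φ k) * ((k:ℝ) + 3) / γ (φ k) = (k:ℝ) + 3 := fun k =>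
    mul_div_cancel_left₀ _ (hγpos _).ne'
  have hr₀γ : ∀ k, γ (φ k) * (2 * √2) / γ (φ k) = 2 * √2 := fun k =>
    mul_div_cancel_left₀ _ (hγpos _).ne'
  have hsqrt : 2 * √2 < 3 := by
    nlinarith [Real.sq_sqrt (zero_le_two (α := ℝ)), Real.sqrt_nonneg 2]
  refine ⟨z0_zero, by simp [deriv_z0], fun r hr => z0_ode hr, integral_Ioi_mass_z0, φ, hφ,
    fun k => γ (φ k) * ((k:ℝ) + 3), fun k => ⟨hρ0 k, hρ1 k⟩, hγ0.comp hφ.tendsto_atTop,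
    squeeze_zero (fun k => (hρ0 k).le) (fun k => (hρlt k).le) hkinv, ?_, ?_, ?_, ?_,
    fun k => γ (φ k) * (2 * √2), ?_, ?_, (hheight _ (by positivity)).comp hφ.tendsto_atTop, ?_⟩
  · simpa only [hργ] using hkInf
  · exact tendsto_iff_dist_tendsto_zero.2
      (squeeze_zero (fun _ => dist_nonneg) (fun k => (hφP k).2.1) hkinv)
  · intro ε hε
    simp only [hργ]
    filter_upwards [hkinv.eventually_lt_const hε] with k hkε r hr
    have e : 1 / ((k:ℝ) + 3) ^ 2 ≤ ε := by
      refine le_trans ?_ hkε.le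
      exact one_div_le_one_div_of_le (by linarith [hk k]) (by nlinarith [hk k])
    exact ⟨((hφP k).2.2 r hr).1.trans e, ((hφP k).2.2 r hr).2.trans e⟩
  · have e1 : Tendsto (fun k : ℕ => -(((k:ℝ) + 3) * deriv z0 ((k:ℝ) + 3))) atTop (𝓝 4) := by
      refine (tendsto_mass_z0.comp hkInf).congr fun k => ?_
      simp only [deriv_z0, Function.comp]
      ring
    refine (tendsto_iff_of_dist (squeeze_zero (fun _ => dist_nonneg) (fun k => ?_) hkinv)).1 e1
    have hk0 : (0:ℝ) < (k:ℝ) + 3 := by linarith [hk k]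
    have e2 := ((hφP k).2.2 _ ⟨hk0.le, le_rfl⟩).2
    rw [hmass _ _ hk0 (hρ1 k), Real.dist_eq]
    calc _ = ((k:ℝ) + 3) * |deriv (z (φ k)) ((k:ℝ) + 3) - deriv z0 ((k:ℝ) + 3)| := by
          rw [← abs_of_pos hk0, ← abs_mul, abs_of_pos hk0]; ring_nf
      _ ≤ ((k:ℝ) + 3) * (1 / ((k:ℝ) + 3) ^ 2) := mul_le_mul_of_nonneg_left e2 hk0.le
      _ = _ := by field_simp
  · exact fun k => ⟨mul_pos (hγpos _) (by positivity),
      mul_lt_mul_of_pos_left (hsqrt.trans_le (hk k)) (hγpos _)⟩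
  · simp only [hr₀γ]
    exact tendsto_const_nhds
  · have e1 : Tendsto (fun n => 8 * (u n (γ n * (2 * √2)) / μ n) ^ (p - 1)
        * (f (u n (γ n * (2 * √2))) / f (μ n))) atTop (𝓝 2) := by
      have := (((hheight (2 * √2) (by positivity)).rpow_const (p := p - 1)
        (Or.inl one_ne_zero)).const_mul 8).mul hinner
      norm_num at this
      exact this
    have e2 : ∀ᶠ n in atTop, 8 * (u n (γ n * (2 * √2)) / μ n) ^ (p - 1)
        * (f (u n (γ n * (2 * √2))) / f (μ n))
        = p * lam n * (γ n * (2 * √2)) ^ 2 * u n (γ n * (2 * √2)) ^ (p - 1)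
          * f (u n (γ n * (2 * √2))) := by
      filter_upwards [hγR (2 * √2) (by positivity)] with n hn
      have h1 := hμ n
      have h2 := Real.rpow_pos_of_pos h1 (p - 1)
      have h3 := hfμ n
      rw [Real.div_rpow (hunn n _ ⟨mul_nonneg (hγpos n).le (by positivity), hn.le⟩) h1.le,
        mul_pow, mul_pow, Real.sq_sqrt zero_le_two]
      have h4 : 1 / (μ n ^ (p - 1) * f (μ n)) = p * lam n * γ n ^ 2 := by
        rw [div_eq_iff (by positivity)]; linear_combination -hγ n
      calc _ = 8 * u n (γ n * (2 * √2)) ^ (p - 1) * f (u n (γ n * (2 * √2)))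
            * (1 / (μ n ^ (p - 1) * f (μ n))) := by field_simp
        _ = _ := by rw [h4]; ring
    exact (e1.congr' e2).comp hφ.tendsto_atTop
end

section
/- Assume p = 2, (H1), and let (λ_n, μ_n, u_n) be a sequence of solutions of (q) with μ_n → ∞. Then, up to a subsequence, there exists a sequence (r_n) ⊂ (0,1) such that u_n(r_n)/μ_n → 0 as n → ∞ and 2·μ_n·∫₀^{r_n} λ_n f(u_n(r))·r dr → 4. Moreover, (log(1/λ_n))/μ_n² → 0 as n → ∞. -/
open Filter

theorem le_of_hasDerivAt_nonneg {g g' : ℝ → ℝ} {a b : ℝ} (hab : a ≤ b)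
    (hc : ContinuousOn g (Set.Icc a b)) (hd : ∀ x ∈ Set.Ioo a b, HasDerivAt g (g' x) x)
    (hg : ∀ x ∈ Set.Ioo a b, 0 ≤ g' x) : g a ≤ g b := by
  refine monotoneOn_of_deriv_nonneg (convex_Icc a b) hc ?_ ?_
    (Set.left_mem_Icc.2 hab) (Set.right_mem_Icc.2 hab) hab
  · rw [interior_Icc]
    exact fun x hx => (hd x hx).differentiableAt.differentiableWithinAt
  · rw [interior_Icc]
    exact fun x hx => by rw [(hd x hx).deriv]; exact hg x hx

/-- `f` is positive on `[T, ∞)`, with logarithmic derivative between `2 (1 - δ) t` and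
`2 (1 + δ) t`. -/
structure GaussianGrowth (f f' : ℝ → ℝ) (T δ : ℝ) : Prop where
  T_pos : 0 < T
  pos : ∀ t, T ≤ t → 0 < f t
  hasDerivAt : ∀ t, T ≤ t → HasDerivAt f (f' t) t
  lower : ∀ t, T ≤ t → 2 * (1 - δ) * t * f t ≤ f' t
  upper : ∀ t, T ≤ t → f' t ≤ 2 * (1 + δ) * t * f t

/-- A radial solution `u` on the unit disc, written as a first order system for `u` and its
flux `m r = -r * u' r`. -/
structure RadialSystem (f : ℝ → ℝ) (lam μ : ℝ) (u m : ℝ → ℝ) : Prop where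
  f_nonneg : ∀ t, 0 ≤ t → 0 ≤ f t
  lam_pos : 0 < lam
  u_nonneg : ∀ r ∈ Set.Icc (0 : ℝ) 1, 0 ≤ u r
  u_cont : ContinuousOn u (Set.Icc 0 1)
  m_cont : ContinuousOn m (Set.Icc 0 1)
  u_deriv : ∀ r ∈ Set.Ioo (0 : ℝ) 1, HasDerivAt u (-m r / r) r
  m_deriv : ∀ r ∈ Set.Ioo (0 : ℝ) 1, HasDerivAt m (lam * f (u r) * r) r
  u_zero : u 0 = μ
  m_zero : m 0 = 0
  u_one : u 1 = 0

namespace GaussianGrowth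

variable {f f' : ℝ → ℝ} {T δ : ℝ}

theorem log_sub_lower (hf : GaussianGrowth f f' T δ) {s t : ℝ} (hs : T ≤ s) (hst : s ≤ t) :
    (1 - δ) * (t ^ 2 - s ^ 2) ≤ Real.log (f t) - Real.log (f s) := by
  have hd : ∀ x, T ≤ x → HasDerivAt (fun x => Real.log (f x) - (1 - δ) * x ^ 2)
      (f' x / f x - (1 - δ) * (2 * x)) x := fun x hx => by
    refine (((hf.hasDerivAt x hx).log (hf.pos x hx).ne').sub
      ((hasDerivAt_pow 2 x).const_mul (1 - δ))).congr_deriv ?_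
    norm_num
  have := le_of_hasDerivAt_nonneg hst
    (fun x hx => (hd x (hs.trans hx.1)).continuousAt.continuousWithinAt)
    (fun x hx => hd x (hs.trans hx.1.le)) (fun x hx => by
      have h1 := hf.lower x (hs.trans hx.1.le)
      have := (le_div_iff₀ (hf.pos x (hs.trans hx.1.le))).2 h1
      linarith)
  linarith

theorem log_sub_upper (hf : GaussianGrowth f f' T δ) {s t : ℝ} (hs : T ≤ s) (hst : s ≤ t) :
    Real.log (f t) - Real.log (f s) ≤ (1 + δ) * (t ^ 2 - s ^ 2) := by
  have hd : ∀ x, T ≤ x → HasDerivAt (fun x => (1 + δ) * x ^ 2 - Real.log (f x))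
      ((1 + δ) * (2 * x) - f' x / f x) x := fun x hx => by
    refine (((hasDerivAt_pow 2 x).const_mul (1 + δ)).sub
      ((hf.hasDerivAt x hx).log (hf.pos x hx).ne')).congr_deriv ?_
    norm_num
  have := le_of_hasDerivAt_nonneg hst
    (fun x hx => (hd x (hs.trans hx.1)).continuousAt.continuousWithinAt)
    (fun x hx => hd x (hs.trans hx.1.le)) (fun x hx => by
      have h1 := hf.upper x (hs.trans hx.1.le)
      have := (div_le_iff₀ (hf.pos x (hs.trans hx.1.le))).2 h1
      linarith)
  linarith

end GaussianGrowth

namespace RadialSystem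

variable {f f' : ℝ → ℝ} {lam μ T δ : ℝ} {u m : ℝ → ℝ}

theorem monotoneOn_flux (hS : RadialSystem f lam μ u m) : MonotoneOn m (Set.Icc 0 1) := by
  intro a ha b hb hab
  refine le_of_hasDerivAt_nonneg hab (hS.m_cont.mono (Set.Icc_subset_Icc ha.1 hb.2))
    (fun x hx => hS.m_deriv x ⟨ha.1.trans_lt hx.1, hx.2.trans_le hb.2⟩) (fun x hx => ?_)
  have hx0 := ha.1.trans_lt hx.1
  exact mul_nonneg (mul_nonneg hS.lam_pos.le
    (hS.f_nonneg _ (hS.u_nonneg x ⟨hx0.le, hx.2.le.trans hb.2⟩))) hx0.le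

theorem flux_nonneg (hS : RadialSystem f lam μ u m) {r : ℝ} (hr : r ∈ Set.Icc (0 : ℝ) 1) :
    0 ≤ m r := by
  have := hS.monotoneOn_flux (Set.left_mem_Icc.2 zero_le_one) hr hr.1
  rwa [hS.m_zero] at this

/-- `u + k log r` is nonincreasing where the flux is at least `k`. -/
theorem log_sub_le (hS : RadialSystem f lam μ u m) {k a b : ℝ} (ha : 0 < a) (hab : a ≤ b)
    (hb : b ≤ 1) (hk : k ≤ m a) : k * (Real.log b - Real.log a) ≤ u a - u b := by
  have := le_of_hasDerivAt_nonneg (g := fun x => -(u x + k * Real.log x))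
    (g' := fun x => -(-m x / x + k * x⁻¹)) hab ?_ ?_ ?_
  · linarith
  · have h1 := hS.u_cont.mono (Set.Icc_subset_Icc ha.le hb)
    have h2 : ContinuousOn Real.log (Set.Icc a b) :=
      Real.continuousOn_log.mono fun x hx => (ha.trans_le hx.1).ne'
    fun_prop
  · intro x hx
    have hx0 := ha.trans hx.1
    exact ((hS.u_deriv x ⟨hx0, hx.2.trans_le hb⟩).add
      ((Real.hasDerivAt_log hx0.ne').const_mul k)).neg
  · intro x hx
    have hx0 := ha.trans hx.1
    have : m a ≤ m x := hS.monotoneOn_flux ⟨ha.le, hab.trans hb⟩ ⟨hx0.le, hx.2.le.trans hb⟩ hx.1.le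
    have e : -(-m x / x + k * x⁻¹) = (m x - k) / x := by field_simp; ring
    rw [e]
    exact div_nonneg (by linarith) hx0.le

/-- `u + k log r` is nondecreasing where the flux is at most `k`. -/
theorem le_log_sub (hS : RadialSystem f lam μ u m) {k a b : ℝ} (ha : 0 < a) (hab : a ≤ b)
    (hb : b ≤ 1) (hk : m b ≤ k) : u a - u b ≤ k * (Real.log b - Real.log a) := by
  have := le_of_hasDerivAt_nonneg (g := fun x => u x + k * Real.log x)
    (g' := fun x => -m x / x + k * x⁻¹) hab ?_ ?_ ?_
  · linarith
  · have h1 := hS.u_cont.mono (Set.Icc_subset_Icc ha.le hb)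
    have h2 : ContinuousOn Real.log (Set.Icc a b) :=
      Real.continuousOn_log.mono fun x hx => (ha.trans_le hx.1).ne'
    fun_prop
  · intro x hx
    have hx0 := ha.trans hx.1
    exact (hS.u_deriv x ⟨hx0, hx.2.trans_le hb⟩).add ((Real.hasDerivAt_log hx0.ne').const_mul k)
  · intro x hx
    have hx0 := ha.trans hx.1
    have : m x ≤ m b := hS.monotoneOn_flux ⟨hx0.le, hx.2.le.trans hb⟩ ⟨ha.le.trans hab, hb⟩ hx.2.le
    have e : -m x / x + k * x⁻¹ = (k - m x) / x := by field_simp; ring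
    rw [e]
    exact div_nonneg (by linarith) hx0.le

theorem antitoneOn (hS : RadialSystem f lam μ u m) : AntitoneOn u (Set.Icc 0 1) := by
  intro a ha b hb hab
  have := le_of_hasDerivAt_nonneg (g := fun x => -u x) (g' := fun x => -(-m x / x)) hab
    (hS.u_cont.mono (Set.Icc_subset_Icc ha.1 hb.2)).neg
    (fun x hx => (hS.u_deriv x ⟨ha.1.trans_lt hx.1, hx.2.trans_le hb.2⟩).neg) (fun x hx => ?_)
  · linarith
  · have hx0 := ha.1.trans_lt hx.1
    have := div_nonneg (hS.flux_nonneg ⟨hx0.le, hx.2.le.trans hb.2⟩) hx0.le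
    rw [neg_div]; linarith

theorem le_center (hS : RadialSystem f lam μ u m) {r : ℝ} (hr : r ∈ Set.Icc (0 : ℝ) 1) :
    u r ≤ μ := hS.u_zero ▸ hS.antitoneOn (Set.left_mem_Icc.2 zero_le_one) hr hr.1

theorem exists_level (hS : RadialSystem f lam μ u m) {c : ℝ} (hc : 0 < c) (hcμ : c < μ) :
    ∃ r ∈ Set.Ioo (0 : ℝ) 1, u r = c := by
  have := intermediate_value_Ioo' zero_le_one hS.u_cont
  rw [hS.u_zero, hS.u_one] at this
  exact this ⟨hc, hcμ⟩

theorem hasDerivAt_density (hS : RadialSystem f lam μ u m) (hf : GaussianGrowth f f' T δ) {r : ℝ}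
    (hr : r ∈ Set.Ioo (0 : ℝ) 1) (hT : T ≤ u r) :
    HasDerivAt (fun x => lam * f (u x) * x ^ 2)
      (2 * lam * f (u r) * r - lam * m r * r * f' (u r)) r := by
  have h1 := (((hf.hasDerivAt _ hT).comp r (hS.u_deriv r hr)).const_mul lam).mul (hasDerivAt_pow 2 r)
  refine h1.congr_deriv ?_
  have := hr.1.ne'
  simp only [Function.comp]
  field_simp
  push_cast
  ring

theorem continuousOn_density (hS : RadialSystem f lam μ u m) (hf : GaussianGrowth f f' T δ) {R : ℝ}
    (hR : R ∈ Set.Icc (0 : ℝ) 1) (hT : T ≤ u R) :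
    ContinuousOn (fun x => lam * f (u x) * x ^ 2) (Set.Icc 0 R) := by
  have h1 := hS.u_cont.mono (Set.Icc_subset_Icc le_rfl hR.2)
  have h2 : ContinuousOn f (Set.Ici T) :=
    fun t ht => (hf.hasDerivAt t ht).continuousAt.continuousWithinAt
  have h3 : ContinuousOn (fun x => f (u x)) (Set.Icc 0 R) := h2.comp h1 fun x hx =>
    hT.trans (hS.antitoneOn ⟨hx.1, hx.2.trans hR.2⟩ hR hx.2)
  exact (continuousOn_const.mul h3).mul (continuousOn_id.pow 2)

theorem density_lower (hS : RadialSystem f lam μ u m) (hf : GaussianGrowth f f' T δ) (hδ : 0 ≤ δ)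
    {R : ℝ} (hR : R ∈ Set.Icc (0 : ℝ) 1) (hT : T ≤ u R) :
    2 * m R - (1 + δ) * μ * m R ^ 2 ≤ lam * f (u R) * R ^ 2 := by
  have key := le_of_hasDerivAt_nonneg hR.1
    (g := fun x => lam * f (u x) * x ^ 2 - 2 * m x + (1 + δ) * μ * m x ^ 2)
    (g' := fun x => lam * m x * x * (2 * (1 + δ) * μ * f (u x) - f' (u x))) ?_ ?_ ?_
  · simp only [hS.m_zero] at key
    linarith
  · have h1 := hS.continuousOn_density hf hR hT
    have h2 := hS.m_cont.mono (Set.Icc_subset_Icc (le_refl 0) hR.2)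
    fun_prop
  · intro x hx
    have hx1 : x ∈ Set.Ioo (0 : ℝ) 1 := ⟨hx.1, hx.2.trans_le hR.2⟩
    have hTx := hT.trans (hS.antitoneOn ⟨hx1.1.le, hx1.2.le⟩ hR hx.2.le)
    refine (((hS.hasDerivAt_density hf hx1 hTx).sub ((hS.m_deriv x hx1).const_mul 2)).add
      (((hS.m_deriv x hx1).pow 2).const_mul ((1 + δ) * μ))).congr_deriv ?_
    push_cast
    ring
  · intro x hx
    have hx1 : x ∈ Set.Icc (0 : ℝ) 1 := ⟨hx.1.le, hx.2.le.trans hR.2⟩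
    have hTx := hT.trans (hS.antitoneOn hx1 hR hx.2.le)
    have h1 := hf.upper _ hTx
    have h2 : 2 * (1 + δ) * u x * f (u x) ≤ 2 * (1 + δ) * μ * f (u x) := by
      have := hf.pos _ hTx
      have := hS.le_center hx1
      gcongr
    exact mul_nonneg (mul_nonneg (mul_nonneg hS.lam_pos.le (hS.flux_nonneg hx1)) hx.1.le)
      (by linarith)

theorem density_upper (hS : RadialSystem f lam μ u m) (hf : GaussianGrowth f f' T δ) (hδ : δ ≤ 1)
    {R : ℝ} (hR : R ∈ Set.Icc (0 : ℝ) 1) (hT : T ≤ u R) :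
    lam * f (u R) * R ^ 2 ≤ 2 * m R - (1 - δ) * u R * m R ^ 2 := by
  have key := le_of_hasDerivAt_nonneg hR.1
    (g := fun x => 2 * m x - (1 - δ) * (u x * m x ^ 2) - lam * f (u x) * x ^ 2)
    (g' := fun x => (1 - δ) * (m x ^ 3 / x) +
      lam * m x * x * (f' (u x) - 2 * (1 - δ) * u x * f (u x))) ?_ ?_ ?_
  · simp only [hS.m_zero] at key
    linarith
  · have h1 := hS.continuousOn_density hf hR hT
    have h2 := hS.m_cont.mono (Set.Icc_subset_Icc (le_refl 0) hR.2)
    have h3 := hS.u_cont.mono (Set.Icc_subset_Icc (le_refl 0) hR.2)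
    fun_prop
  · intro x hx
    have hx1 : x ∈ Set.Ioo (0 : ℝ) 1 := ⟨hx.1, hx.2.trans_le hR.2⟩
    have hTx := hT.trans (hS.antitoneOn ⟨hx1.1.le, hx1.2.le⟩ hR hx.2.le)
    refine ((((hS.m_deriv x hx1).const_mul 2).sub
      (((hS.u_deriv x hx1).mul ((hS.m_deriv x hx1).pow 2)).const_mul (1 - δ))).sub
        (hS.hasDerivAt_density hf hx1 hTx)).congr_deriv ?_
    simp only [Pi.pow_apply]
    push_cast
    ring
  · intro x hx
    have hx1 : x ∈ Set.Icc (0 : ℝ) 1 := ⟨hx.1.le, hx.2.le.trans hR.2⟩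
    have hTx := hT.trans (hS.antitoneOn hx1 hR hx.2.le)
    have h1 := hf.lower _ hTx
    have h0 := hS.flux_nonneg hx1
    exact add_nonneg (mul_nonneg (by linarith) (div_nonneg (pow_nonneg h0 3) hx.1.le))
      (mul_nonneg (mul_nonneg (mul_nonneg hS.lam_pos.le h0) hx.1.le) (by linarith))

theorem flux_upper (hS : RadialSystem f lam μ u m) (hf : GaussianGrowth f f' T δ) (hδ : δ ≤ 1)
    {R : ℝ} (hR : R ∈ Set.Icc (0 : ℝ) 1) (hT : T ≤ u R) : (1 - δ) * u R * m R ≤ 2 := by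
  have h1 := hS.density_upper hf hδ hR hT
  have h2 : 0 ≤ lam * f (u R) * R ^ 2 :=
    mul_nonneg (mul_nonneg hS.lam_pos.le (hf.pos _ hT).le) (sq_nonneg R)
  rcases (hS.flux_nonneg hR).eq_or_lt with h | h
  · rw [← h]; norm_num
  · by_contra! hc
    nlinarith [mul_lt_mul_of_pos_left hc h]

/-- Once `u` has dropped by a fixed proportion, the flux is almost that of a full bubble. -/
theorem flux_lower (hS : RadialSystem f lam μ u m) (hf : GaussianGrowth f f' T δ) (hδ : 0 < δ)
    (hμ : 0 < μ) (hμδ : 1 < δ ^ 2 * μ ^ 2)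
    {R : ℝ} (hR : R ∈ Set.Icc (0 : ℝ) 1) (hT : T ≤ u R) (huR : u R ≤ (1 - δ) * μ) :
    2 * (1 - δ) / ((1 + δ) * μ) ≤ m R := by
  by_contra! hc
  rw [lt_div_iff₀ (by positivity)] at hc
  have key := le_of_hasDerivAt_nonneg hR.1 (g := fun x => 2 * δ * u x + m x)
    (g' := fun x => 2 * δ * (-m x / x) + lam * f (u x) * x) ?_ ?_ ?_
  · simp only [hS.m_zero, hS.u_zero] at key
    have h3 : m R * μ < 2 := by nlinarith [mul_nonneg (mul_nonneg hδ.le (hS.flux_nonneg hR)) hμ.le]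
    have h4 : 2 * δ ^ 2 * μ ≤ m R := by nlinarith
    nlinarith
  · have h2 := hS.m_cont.mono (Set.Icc_subset_Icc (le_refl 0) hR.2)
    have h3 := hS.u_cont.mono (Set.Icc_subset_Icc (le_refl 0) hR.2)
    fun_prop
  · intro x hx
    have hx1 : x ∈ Set.Ioo (0 : ℝ) 1 := ⟨hx.1, hx.2.trans_le hR.2⟩
    exact ((hS.u_deriv x hx1).const_mul (2 * δ)).add (hS.m_deriv x hx1)
  · intro x hx
    have hx1 : x ∈ Set.Icc (0 : ℝ) 1 := ⟨hx.1.le, hx.2.le.trans hR.2⟩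
    have hTx := hT.trans (hS.antitoneOn hx1 hR hx.2.le)
    have h1 := hS.density_lower hf hδ.le hx1 hTx
    have h2 := hS.monotoneOn_flux hx1 hR hx.2.le
    have h0 := hS.flux_nonneg hx1
    have h4 : m x * ((1 + δ) * μ) ≤ 2 * (1 - δ) := by
      have : m x * ((1 + δ) * μ) ≤ m R * ((1 + δ) * μ) := by gcongr
      linarith
    have e : 2 * δ * (-m x / x) + lam * f (u x) * x =
        (lam * f (u x) * x ^ 2 - 2 * δ * m x) / x := by
      have := hx.1.ne'
      field_simp; ring
    rw [e]
    refine div_nonneg ?_ hx.1.le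
    nlinarith [mul_le_mul_of_nonneg_left h4 h0]

theorem log_density (hS : RadialSystem f lam μ u m) {r : ℝ} (hr : 0 < r) (hf : 0 < f (u r)) :
    Real.log (lam * f (u r) * r ^ 2) =
      Real.log lam + Real.log (f (u r)) + 2 * Real.log r := by
  have h1 := hS.lam_pos.ne'
  rw [Real.log_mul (mul_ne_zero h1 hf.ne') (pow_ne_zero 2 hr.ne'), Real.log_mul h1 hf.ne',
    Real.log_pow]
  norm_num

/-- Outside the first bubble the density decays exponentially in `u`, so that the flux hardly
increases any more. -/
theorem flux_tail (hS : RadialSystem f lam μ u m) (hf : GaussianGrowth f f' T δ)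
    {R₀ R k c : ℝ} (hR₀ : 0 < R₀) (hRR : R₀ ≤ R) (hR1 : R ≤ 1) (hT : T ≤ u R) (hk : 0 < k)
    (hkm : k ≤ m R₀) (hc : 0 < c) (hkc : 2 / k + c ≤ (1 - δ) * (u R₀ + u R)) (hδ : δ ≤ 1) :
    m R ≤ m R₀ + lam * f (u R₀) * R₀ ^ 2 / (k * c) := by
  set F₀ := lam * f (u R₀) * R₀ ^ 2 with hF₀
  have hRm : R ∈ Set.Icc (0 : ℝ) 1 := ⟨hR₀.le.trans hRR, hR1⟩
  have hRm₀ : R₀ ∈ Set.Icc (0 : ℝ) 1 := ⟨hR₀.le, hRR.trans hR1⟩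
  have hTx : ∀ x ∈ Set.Icc R₀ R, T ≤ u x := fun x hx =>
    hT.trans (hS.antitoneOn ⟨hR₀.le.trans hx.1, hx.2.trans hR1⟩ hRm hx.2)
  have hpos : ∀ x ∈ Set.Icc R₀ R, 0 < lam * f (u x) * x ^ 2 := fun x hx =>
    mul_pos (mul_pos hS.lam_pos (hf.pos _ (hTx x hx))) (pow_pos (hR₀.trans_le hx.1) 2)
  have hdecay : ∀ x ∈ Set.Icc R₀ R,
      lam * f (u x) * x ^ 2 ≤ F₀ * Real.exp (c * (u x - u R₀)) := by
    intro x hx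
    have hF₀pos : 0 < F₀ := hpos R₀ ⟨le_rfl, hRR⟩
    rw [← Real.log_le_log_iff (hpos x hx) (by positivity),
      Real.log_mul hF₀pos.ne' (Real.exp_pos _).ne', Real.log_exp, hF₀,
      hS.log_density (hR₀.trans_le hx.1) (hf.pos _ (hTx x hx)),
      hS.log_density hR₀ (hf.pos _ (hTx R₀ ⟨le_rfl, hRR⟩))]
    have hx1 : x ∈ Set.Icc (0 : ℝ) 1 := ⟨hR₀.le.trans hx.1, hx.2.trans hR1⟩
    have hux : u x ≤ u R₀ := hS.antitoneOn hRm₀ hx1 hx.1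
    have hRx : u R ≤ u x := hS.antitoneOn hx1 hRm hx.2
    have h1 := hf.log_sub_lower (hTx x hx) hux
    have h2 := hS.log_sub_le hR₀ hx.1 (hx.2.trans hR1) hkm
    have h3 : Real.log x - Real.log R₀ ≤ (u R₀ - u x) / k := by
      rw [le_div_iff₀ hk]; linarith
    have h4 : (2 / k + c) * (u R₀ - u x) ≤ (1 - δ) * (u R₀ + u x) * (u R₀ - u x) := by
      refine mul_le_mul_of_nonneg_right (hkc.trans ?_) (by linarith)
      exact mul_le_mul_of_nonneg_left (by linarith) (by linarith)
    have e : (2 / k + c) * (u R₀ - u x) = 2 * ((u R₀ - u x) / k) + c * (u R₀ - u x) := by ring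
    nlinarith
  have key := le_of_hasDerivAt_nonneg hRR
    (g := fun x => -(m x + F₀ / (k * c) * Real.exp (c * (u x - u R₀))))
    (g' := fun x => -(lam * f (u x) * x +
      F₀ / (k * c) * (Real.exp (c * (u x - u R₀)) * (c * (-m x / x))))) ?_ ?_ ?_
  · have : 0 ≤ F₀ / (k * c) * Real.exp (c * (u R - u R₀)) := by
      have : 0 < F₀ := hpos R₀ ⟨le_rfl, hRR⟩
      positivity
    simp only [sub_self, mul_zero, Real.exp_zero, mul_one] at key
    linarith
  · have h2 := hS.m_cont.mono (Set.Icc_subset_Icc hR₀.le hR1)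
    have h3 := hS.u_cont.mono (Set.Icc_subset_Icc hR₀.le hR1)
    fun_prop
  · intro x hx
    have hx1 : x ∈ Set.Ioo (0 : ℝ) 1 := ⟨hR₀.trans hx.1, hx.2.trans_le hR1⟩
    exact ((hS.m_deriv x hx1).add
      ((((hS.u_deriv x hx1).sub_const _).const_mul c).exp.const_mul _)).neg
  · intro x hx
    have hx0 : 0 < x := hR₀.trans hx.1
    have h1 := hdecay x ⟨hx.1.le, hx.2.le⟩
    have h2 := hpos x ⟨hx.1.le, hx.2.le⟩
    have h3 : k ≤ m x :=
      hkm.trans (hS.monotoneOn_flux hRm₀ ⟨hx0.le, hx.2.le.trans hR1⟩ hx.1.le)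
    have e : -(lam * f (u x) * x +
        F₀ / (k * c) * (Real.exp (c * (u x - u R₀)) * (c * (-m x / x)))) =
        (F₀ * Real.exp (c * (u x - u R₀)) * m x - lam * f (u x) * x ^ 2 * k) / (k * x) := by
      field_simp
      ring
    rw [e]
    refine div_nonneg (sub_nonneg.2 ?_) (by positivity)
    exact mul_le_mul h1 h3 hk.le (h2.le.trans h1)

/-- Radii enclosing the first bubble: up to `R₀` almost all of its flux is reached, and up to `R`,
where `u` has fallen to `ε * μ`, hardly any further flux is gained. -/
theorem exists_radii (hS : RadialSystem f lam μ u m) (hf : GaussianGrowth f f' T δ) {ε : ℝ}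
    (hε : 0 < ε) (hε2 : ε ≤ 1 / 2) (hδ : δ = ε ^ 2 / 1000) (hμ0 : 0 < μ)
    (hμδ : 1 < δ ^ 2 * μ ^ 2) (hT : T ≤ ε * μ) :
    ∃ R₀ ∈ Set.Ioo (0 : ℝ) 1, ∃ R ∈ Set.Ioo (0 : ℝ) 1, R₀ ≤ R ∧ u R₀ = (1 - δ) * μ ∧
      u R = ε * μ ∧ (2 - 4 * δ) / μ ≤ m R₀ ∧ μ * m R ≤ 2 + ε / 20 ∧
      μ * (lam * f (u R₀) * R₀ ^ 2) ≤ 20 * δ := by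
  have hδ0 : 0 < δ := by rw [hδ]; positivity
  have hδε : δ ≤ ε / 2000 := by rw [hδ]; nlinarith
  obtain ⟨R₀, hR₀, hu₀⟩ := hS.exists_level (c := (1 - δ) * μ) (by nlinarith) (by nlinarith)
  obtain ⟨R, hR, huR⟩ := hS.exists_level (c := ε * μ) (by positivity) (by nlinarith)
  have hR' : R ∈ Set.Icc (0 : ℝ) 1 := ⟨hR.1.le, hR.2.le⟩
  have hR₀' : R₀ ∈ Set.Icc (0 : ℝ) 1 := ⟨hR₀.1.le, hR₀.2.le⟩
  have hlt : ε * μ < (1 - δ) * μ := by nlinarith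
  have hRR : R₀ ≤ R := by
    by_contra! hc
    have := hS.antitoneOn hR' hR₀' hc.le
    linarith
  have hT₀ : T ≤ u R₀ := by linarith
  have hTR : T ≤ u R := by linarith
  set k := (2 - 4 * δ) / μ with hk
  have hk0 : 0 < k := div_pos (by linarith) hμ0
  have hkm : k ≤ m R₀ := by
    refine le_trans ?_ (hS.flux_lower hf hδ0 hμ0 hμδ hR₀' hT₀ hu₀.le)
    rw [hk, div_le_div_iff₀ hμ0 (by positivity)]
    nlinarith [mul_pos hδ0 hδ0, mul_pos (mul_pos hδ0 hδ0) hμ0]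
  have hM₀lower : 2 - 4 * δ ≤ μ * m R₀ := by
    rw [hk, div_le_iff₀ hμ0] at hkm; linarith
  have hM₀ : (1 - δ) ^ 2 * (μ * m R₀) ≤ 2 := by
    have := hS.flux_upper hf (by linarith) hR₀' hT₀
    rw [hu₀] at this; linarith
  have hM₀upper : μ * m R₀ ≤ 2 + 5 * δ := by
    by_contra! hc
    have : (1 - δ) ^ 2 * (2 + 5 * δ) < (1 - δ) ^ 2 * (μ * m R₀) :=
      mul_lt_mul_of_pos_left hc (pow_pos (by linarith) 2)
    nlinarith [mul_pos hδ0 hδ0, mul_pos (mul_pos hδ0 hδ0) hδ0]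
  have hF₀pos : 0 < lam * f (u R₀) * R₀ ^ 2 :=
    mul_pos (mul_pos hS.lam_pos (hf.pos _ hT₀)) (pow_pos hR₀.1 2)
  have hF₀ : μ * (lam * f (u R₀) * R₀ ^ 2) ≤ 20 * δ := by
    have h1 := mul_le_mul_of_nonneg_left (hS.density_upper hf (by linarith) hR₀' hT₀) hμ0.le
    have e : μ * (2 * m R₀ - (1 - δ) * u R₀ * m R₀ ^ 2) =
        (μ * m R₀) * (2 - (1 - δ) ^ 2 * (μ * m R₀)) := by rw [hu₀]; ring
    have h2 : 2 - (1 - δ) ^ 2 * (μ * m R₀) ≤ 8 * δ := by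
      have : (1 - 2 * δ) * (2 - 4 * δ) ≤ (1 - δ) ^ 2 * (μ * m R₀) :=
        mul_le_mul (by nlinarith) hM₀lower (by linarith) (sq_nonneg _)
      nlinarith
    have h3 : (μ * m R₀) * (2 - (1 - δ) ^ 2 * (μ * m R₀)) ≤ (5 / 2) * (8 * δ) :=
      mul_le_mul (by linarith) h2 (by linarith) (by norm_num)
    linarith
  have h2k : 2 / k ≤ (1 + 3 * δ) * μ := by
    rw [div_le_iff₀ hk0, hk, mul_assoc, mul_div_cancel₀ _ hμ0.ne']
    nlinarith
  have htail := hS.flux_tail hf hR₀.1 hRR hR.2.le hTR hk0 hkm (c := ε / 2 * μ) (by positivity)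
    (by rw [hu₀, huR]
        have : (1 + 3 * δ + ε / 2) ≤ (1 - δ) * (1 - δ + ε) := by nlinarith
        nlinarith) (by linarith)
  have hM : μ * m R ≤ 2 + ε / 20 := by
    have h1 : lam * f (u R₀) * R₀ ^ 2 / (k * (ε / 2 * μ)) ≤ (ε / 25) / μ := by
      have e : k * (ε / 2 * μ) = (1 - 2 * δ) * ε := by rw [hk]; field_simp; ring
      rw [e, div_le_div_iff₀ (mul_pos (by linarith) hε) hμ0]
      have : 20 * δ ≤ ε / 25 * ((1 - 2 * δ) * ε) := by
        rw [hδ]; nlinarith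
      linarith
    have h2 : μ * m R ≤ μ * (m R₀ + ε / 25 / μ) :=
      mul_le_mul_of_nonneg_left (by linarith) hμ0.le
    rw [mul_add, mul_div_cancel₀ _ hμ0.ne'] at h2
    linarith
  exact ⟨R₀, hR₀, R, hR, hRR, hu₀, huR, hkm, hM, hF₀⟩

/-- The parameter `lam` is not too small. -/
theorem neg_log_le (hS : RadialSystem f lam μ u m) (hf : GaussianGrowth f f' T δ) {ε R₀ R : ℝ}
    (hε : 0 < ε) (hε2 : ε ≤ 1 / 2) (hδ0 : 0 < δ) (hδε : δ ≤ ε / 2000) (hμ0 : 0 < μ)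
    (hT : T ≤ ε * μ) (hfT : |Real.log (f T)| + (1 + δ) * T ^ 2 ≤ δ * μ ^ 2)
    (hlogμ : Real.log (2 * μ) ≤ δ * μ ^ 2) (hR₀ : R₀ ∈ Set.Ioo (0 : ℝ) 1)
    (hR : R ∈ Set.Ioo (0 : ℝ) 1) (hRR : R₀ ≤ R) (hu₀ : u R₀ = (1 - δ) * μ) (huR : u R = ε * μ)
    (hkm : (2 - 4 * δ) / μ ≤ m R₀) (hM : μ * m R ≤ 2 + ε / 20) :
    -Real.log lam ≤ 3 * ε * μ ^ 2 := by
  have hR₀' : R₀ ∈ Set.Icc (0 : ℝ) 1 := ⟨hR₀.1.le, hR₀.2.le⟩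
  have hμ2 : 0 < μ ^ 2 := by positivity
  have hTsq : 0 ≤ T ^ 2 := sq_nonneg T
  have hδT : 0 ≤ δ * T ^ 2 := by positivity
  have habs := abs_le.1 (le_refl |Real.log (f T)|)
  have hlt : ε * μ < (1 - δ) * μ := by nlinarith
  rw [div_le_iff₀ hμ0] at hkm
  obtain ⟨r, hr, hmr⟩ : (1 / (2 * μ)) ∈ m '' Set.Ioc 0 R₀ := by
    refine intermediate_value_Ioc hR₀.1.le
      (hS.m_cont.mono (Set.Icc_subset_Icc le_rfl hR₀.2.le)) ?_
    rw [hS.m_zero]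
    refine ⟨by positivity, ?_⟩
    rw [div_le_iff₀ (by positivity)]
    linarith
  have hr' : r ∈ Set.Icc (0 : ℝ) 1 := ⟨hr.1.le, hr.2.trans hR₀.2.le⟩
  have hur : (1 - δ) * μ ≤ u r := hu₀ ▸ hS.antitoneOn hr' hR₀' hr.2
  have hurμ := hS.le_center hr'
  have hTr : T ≤ u r := by linarith
  have hF := hS.density_lower hf hδ0.le hr' hTr
  have hF1 : 1 / (2 * μ) ≤ lam * f (u r) * r ^ 2 := by
    refine le_trans ?_ hF
    rw [hmr]
    have e : 2 * (1 / (2 * μ)) - (1 + δ) * μ * (1 / (2 * μ)) ^ 2 =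
        1 / (2 * μ) * (2 - (1 + δ) / 2) := by field_simp
    rw [e]
    exact le_mul_of_one_le_right (by positivity) (by linarith)
  have hlog := Real.log_le_log (by positivity) hF1
  rw [hS.log_density hr.1 (hf.pos _ hTr), one_div, Real.log_inv] at hlog
  have hG := hf.log_sub_upper le_rfl hTr
  have hGu : (1 + δ) * (u r ^ 2 - T ^ 2) ≤ (1 + δ) * (μ ^ 2 - T ^ 2) := by
    have : 0 ≤ u r := hS.u_nonneg r hr'
    gcongr
  have hl := hS.le_log_sub (k := (2 + ε / 20) / μ) hr.1 (hr.2.trans hRR) hR.2.le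
    (by rw [le_div_iff₀ hμ0]; linarith)
  have hlR : Real.log R ≤ 0 := Real.log_nonpos hR.1.le hR.2.le
  have hl2 : (1 - δ - ε) * μ ^ 2 ≤ (2 + ε / 20) * -Real.log r := by
    have h1 : (1 - δ) * μ - ε * μ ≤ (2 + ε / 20) / μ * -Real.log r := by
      refine le_trans (by linarith) (hl.trans (mul_le_mul_of_nonneg_left (by linarith) ?_))
      positivity
    rw [div_mul_eq_mul_div, le_div_iff₀ hμ0] at h1
    nlinarith
  have hl3 : (1 - δ - 2 * ε) * μ ^ 2 ≤ 2 * -Real.log r := by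
    by_contra! hc
    have h1 : (2 + ε / 20) * (2 * -Real.log r) < (2 + ε / 20) * ((1 - δ - 2 * ε) * μ ^ 2) :=
      mul_lt_mul_of_pos_left hc (by positivity)
    have h2 : (2 + ε / 20) * (1 - δ - 2 * ε) ≤ 2 * (1 - δ - ε) := by
      nlinarith only [mul_pos hε hδ0, mul_pos hε hε, hε]
    nlinarith only [mul_le_mul_of_nonneg_right h2 hμ2.le, h1, hl2]
  have hfin : 4 * (δ * μ ^ 2) ≤ ε * μ ^ 2 := by
    linarith [mul_le_mul_of_nonneg_right hδε hμ2.le, mul_pos hε hμ2]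
  linarith [habs.2]

/-- The parameter `lam` is not too large. -/
theorem log_le (hS : RadialSystem f lam μ u m) (hf : GaussianGrowth f f' T δ) {ε R₀ : ℝ}
    (hε : 0 < ε) (hε2 : ε ≤ 1 / 2) (hδ0 : 0 < δ) (hδε : δ ≤ ε / 2000) (hμ : 1 ≤ μ)
    (hT : T ≤ ε * μ) (hfT : |Real.log (f T)| + (1 + δ) * T ^ 2 ≤ δ * μ ^ 2)
    (hR₀ : R₀ ∈ Set.Ioo (0 : ℝ) 1) (hu₀ : u R₀ = (1 - δ) * μ)
    (hkm : (2 - 4 * δ) / μ ≤ m R₀) (hF₀ : μ * (lam * f (u R₀) * R₀ ^ 2) ≤ 20 * δ) :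
    Real.log lam ≤ 3 * ε * μ ^ 2 := by
  have hμ0 : 0 < μ := by linarith
  have hμ2 : 0 < μ ^ 2 := by positivity
  have hTsq : 0 ≤ T ^ 2 := sq_nonneg T
  have hδT : 0 ≤ δ * T ^ 2 := by positivity
  have habs := abs_le.1 (le_refl |Real.log (f T)|)
  have hlt : ε * μ < (1 - δ) * μ := by nlinarith
  have hT₀ : T ≤ u R₀ := by linarith
  have hF₀pos : 0 < lam * f (u R₀) * R₀ ^ 2 :=
    mul_pos (mul_pos hS.lam_pos (hf.pos _ hT₀)) (pow_pos hR₀.1 2)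
  have hlog : Real.log (lam * f (u R₀) * R₀ ^ 2) ≤ 0 :=
    Real.log_nonpos hF₀pos.le (by nlinarith)
  rw [hS.log_density hR₀.1 (hf.pos _ hT₀)] at hlog
  have hG := hf.log_sub_lower le_rfl hT₀
  have hl := hS.log_sub_le hR₀.1 hR₀.2.le le_rfl hkm
  rw [Real.log_one, hS.u_one, hu₀, div_mul_eq_mul_div, div_le_iff₀ hμ0] at hl
  have hl2 : -(2 * Real.log R₀) ≤ (1 + 3 * δ) * μ ^ 2 := by
    by_contra! hc
    have h1 : (1 - 2 * δ) * ((1 + 3 * δ) * μ ^ 2) < (1 - 2 * δ) * -(2 * Real.log R₀) :=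
      mul_lt_mul_of_pos_left hc (by linarith)
    have h2 : 1 - δ ≤ (1 - 2 * δ) * (1 + 3 * δ) := by nlinarith
    nlinarith [mul_le_mul_of_nonneg_right h2 hμ2.le]
  have h3 : (1 - 3 * δ) * μ ^ 2 ≤ (1 - δ) * u R₀ ^ 2 := by
    rw [hu₀]
    have : 1 - 3 * δ ≤ (1 - δ) ^ 3 := by nlinarith [mul_pos hδ0 hδ0]
    nlinarith [mul_le_mul_of_nonneg_right this hμ2.le]
  have hfin : 8 * (δ * μ ^ 2) ≤ ε * μ ^ 2 := by
    linarith [mul_le_mul_of_nonneg_right hδε hμ2.le, mul_pos hε hμ2]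
  have : 0 < ε * μ ^ 2 := by positivity
  linarith [habs.1]

theorem exists_radius (hS : RadialSystem f lam μ u m) (hf : GaussianGrowth f f' T δ) {ε : ℝ}
    (hε : 0 < ε) (hε2 : ε ≤ 1 / 2) (hδ : δ = ε ^ 2 / 1000) (hμ : 1 ≤ μ)
    (hμδ : 1 < δ ^ 2 * μ ^ 2) (hT : T ≤ ε * μ)
    (hfT : |Real.log (f T)| + (1 + δ) * T ^ 2 ≤ δ * μ ^ 2)
    (hlogμ : Real.log (2 * μ) ≤ δ * μ ^ 2) :
    ∃ R ∈ Set.Ioo (0 : ℝ) 1, u R = ε * μ ∧ |μ * m R - 2| ≤ ε ∧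
      |Real.log (1 / lam)| ≤ 3 * ε * μ ^ 2 := by
  have hμ0 : 0 < μ := by linarith
  have hδ0 : 0 < δ := by rw [hδ]; positivity
  have hδε : δ ≤ ε / 2000 := by rw [hδ]; nlinarith
  obtain ⟨R₀, hR₀, R, hR, hRR, hu₀, huR, hkm, hM, hF₀⟩ :=
    hS.exists_radii hf hε hε2 hδ hμ0 hμδ hT
  refine ⟨R, hR, huR, abs_le.2 ⟨?_, by linarith⟩, ?_⟩
  · have := hkm.trans
      (hS.monotoneOn_flux ⟨hR₀.1.le, hR₀.2.le⟩ ⟨hR.1.le, hR.2.le⟩ hRR)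
    rw [div_le_iff₀ hμ0] at this
    linarith
  · rw [one_div, Real.log_inv, abs_neg]
    have := hS.neg_log_le hf hε hε2 hδ0 hδε hμ0 hT hfT hlogμ hR₀ hR hRR hu₀ huR hkm hM
    exact abs_le.2 ⟨by linarith, hS.log_le hf hε hε2 hδ0 hδε hμ hT hfT hR₀ hu₀ hkm hF₀⟩

end RadialSystem

theorem RadialSystem.of_solution {f : ℝ → ℝ} (hfc : ContinuousOn f (Set.Ici 0))
    (hf0 : ∀ t, 0 ≤ t → 0 ≤ f t) {lam μ : ℝ} {u : ℝ → ℝ} (hlam : 0 < lam)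
    (huC2 : ContDiffOn ℝ 2 u (Set.Icc 0 1)) (hupos : ∀ r ∈ Set.Ico (0 : ℝ) 1, 0 < u r)
    (hu0 : u 0 = μ) (hu1 : u 1 = 0)
    (heq : ∀ r ∈ Set.Ioo (0 : ℝ) 1, -(deriv (deriv u) r) - deriv u r / r = lam * f (u r)) :
    RadialSystem f lam μ u (fun r => ∫ x in (0 : ℝ)..r, lam * f (u x) * x) := by
  have hnonneg : ∀ r ∈ Set.Icc (0 : ℝ) 1, 0 ≤ u r := fun r hr => by
    rcases hr.2.eq_or_lt with h | h
    · rw [h, hu1]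
    · exact (hupos r ⟨hr.1, h⟩).le
  have hg : ContinuousOn (fun x => lam * f (u x) * x) (Set.Icc 0 1) :=
    (continuousOn_const.mul (hfc.comp huC2.continuousOn hnonneg)).mul continuousOn_id
  have hmc : ContinuousOn (fun r => ∫ x in (0 : ℝ)..r, lam * f (u x) * x) (Set.Icc 0 1) := by
    have := intervalIntegral.continuousOn_primitive_interval (μ := MeasureTheory.volume)
      (f := fun x => lam * f (u x) * x) (a := 0) (b := 1)
    rw [Set.uIcc_of_le zero_le_one] at this
    exact this (hg.integrableOn_Icc)
  have hmd : ∀ r ∈ Set.Ioo (0 : ℝ) 1,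
      HasDerivAt (fun r => ∫ x in (0 : ℝ)..r, lam * f (u x) * x) (lam * f (u r) * r) r := by
    intro r hr
    have hnhds : Set.Icc (0 : ℝ) 1 ∈ nhds r := Icc_mem_nhds hr.1 hr.2
    refine intervalIntegral.integral_hasDerivAt_right ?_ ?_ (hg.continuousAt hnhds)
    · refine ContinuousOn.intervalIntegrable ?_
      rw [Set.uIcc_of_le hr.1.le]
      exact hg.mono (Set.Icc_subset_Icc le_rfl hr.2.le)
    · exact (hg.mono Set.Ioo_subset_Icc_self).stronglyMeasurableAtFilter isOpen_Ioo r hr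
  have hd1 : ∀ r ∈ Set.Ioo (0 : ℝ) 1, HasDerivAt u (deriv u r) r := fun r hr =>
    ((huC2.contDiffAt (Icc_mem_nhds hr.1 hr.2)).differentiableAt (by norm_num)).hasDerivAt
  have hd2 : ∀ r ∈ Set.Ioo (0 : ℝ) 1, HasDerivAt (deriv u) (deriv (deriv u) r) r := by
    intro r hr
    have h1 : ContDiffOn ℝ 1 (deriv u) (Set.Ioo 0 1) :=
      (huC2.mono Set.Ioo_subset_Icc_self).deriv_of_isOpen isOpen_Ioo (by norm_num)
    exact ((h1.contDiffAt (Ioo_mem_nhds hr.1 hr.2)).differentiableAt (by norm_num)).hasDerivAt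
  set v := derivWithin u (Set.Icc 0 1) with hv
  have hvc : ContinuousOn v (Set.Icc 0 1) :=
    huC2.continuousOn_derivWithin (uniqueDiffOn_Icc zero_lt_one) (by norm_num)
  have hvu : ∀ r ∈ Set.Ioo (0 : ℝ) 1, v r = deriv u r := fun r hr =>
    derivWithin_of_mem_nhds (Icc_mem_nhds hr.1 hr.2)
  set w := fun r => r * v r + ∫ x in (0 : ℝ)..r, lam * f (u x) * x with hw
  have hwd : ∀ r ∈ Set.Ioo (0 : ℝ) 1, HasDerivAt w 0 r := by
    intro r hr
    have hvd : HasDerivAt v (deriv (deriv u) r) r :=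
      (hd2 r hr).congr_of_eventuallyEq
        (Filter.eventually_of_mem (Ioo_mem_nhds hr.1 hr.2) hvu)
    refine (((hasDerivAt_id r).mul hvd).add (hmd r hr)).congr_deriv ?_
    have h1 := heq r hr
    have h2 := hr.1.ne'
    rw [hvu r hr, ← h1]
    simp only [id]
    field_simp
    ring
  have hwc : ContinuousOn w (Set.Icc 0 1) := (continuousOn_id.mul hvc).add hmc
  have hw0 : ∀ r ∈ Set.Ioo (0 : ℝ) 1, w r = 0 := by
    intro r hr
    have hc := hwc.mono (Set.Icc_subset_Icc (le_refl 0) hr.2.le)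
    have hsub : ∀ x ∈ Set.Ioo 0 r, x ∈ Set.Ioo (0 : ℝ) 1 := fun x hx => ⟨hx.1, hx.2.trans hr.2⟩
    have h1 := le_of_hasDerivAt_nonneg hr.1.le hc (fun x hx => hwd x (hsub x hx)) (by simp)
    have h2 := le_of_hasDerivAt_nonneg (g := fun x => -w x) (g' := fun _ => -0) hr.1.le hc.neg
      (fun x hx => (hwd x (hsub x hx)).neg) (by simp)
    have h3 : w 0 = 0 := by simp [hw]
    linarith
  refine ⟨hf0, hlam, hnonneg, huC2.continuousOn, hmc, fun r hr => ?_, hmd, hu0, by simp, hu1⟩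
  have h1 := hw0 r hr
  simp only [hw, hvu r hr] at h1
  refine (hd1 r hr).congr_deriv ?_
  rw [eq_div_iff hr.1.ne']
  linarith

theorem exists_gaussianGrowth {h : ℝ → ℝ} (hhC1 : ContDiffOn ℝ 1 h (Set.Ici 0)) {t₀ : ℝ}
    (ht₀ : 0 < t₀) (hhpos : ∀ t : ℝ, t₀ ≤ t → 0 < h t)
    (H1 : Tendsto (fun t : ℝ => deriv h t / (t * h t)) atTop (nhds 0)) {δ : ℝ} (hδ : 0 < δ) :
    ∃ T, GaussianGrowth (fun t => h t * Real.exp (t ^ 2))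
      (fun t => (deriv h t + 2 * t * h t) * Real.exp (t ^ 2)) T δ := by
  have h1 := (Metric.tendsto_nhds.1 H1) (2 * δ) (by positivity)
  obtain ⟨T, hT⟩ := Filter.eventually_atTop.1 h1
  have hpos : ∀ t, max T t₀ ≤ t → 0 < t := fun t ht => ht₀.trans_le ((le_max_right _ _).trans ht)
  have hh : ∀ t, max T t₀ ≤ t → 0 < h t := fun t ht => hhpos t ((le_max_right _ _).trans ht)
  have hbd : ∀ t, max T t₀ ≤ t → |deriv h t| ≤ 2 * δ * (t * h t) := fun t ht => by
    have h2 := hT t ((le_max_left _ _).trans ht)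
    have h3 := mul_pos (hpos t ht) (hh t ht)
    rw [Real.dist_eq, sub_zero, abs_div, abs_of_pos h3, div_lt_iff₀ h3] at h2
    exact h2.le
  refine ⟨max T t₀, hpos _ le_rfl, fun t ht => mul_pos (hh t ht) (Real.exp_pos _),
    fun t ht => ?_, fun t ht => ?_, fun t ht => ?_⟩
  · have hd : HasDerivAt h (deriv h t) t :=
      ((hhC1.contDiffAt (Ici_mem_nhds (hpos t ht))).differentiableAt (by norm_num)).hasDerivAt
    refine (hd.mul (hasDerivAt_pow 2 t).exp).congr_deriv ?_
    push_cast
    ring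
  · have h2 := (abs_le.1 (hbd t ht)).1
    rw [← mul_assoc]
    exact mul_le_mul_of_nonneg_right (by linarith) (Real.exp_pos _).le
  · have h2 := (abs_le.1 (hbd t ht)).2
    rw [← mul_assoc]
    exact mul_le_mul_of_nonneg_right (by linarith) (Real.exp_pos _).le

theorem eventually_exists_radius {f f' : ℝ → ℝ} {lam μ : ℕ → ℝ} {u m : ℕ → ℝ → ℝ}
    (hS : ∀ n, RadialSystem f (lam n) (μ n) (u n) (m n))
    (hf : ∀ δ, 0 < δ → ∃ T, GaussianGrowth f f' T δ) (hμ : Tendsto μ atTop atTop) {ε : ℝ}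
    (hε : 0 < ε) (hε2 : ε ≤ 1 / 2) :
    ∀ᶠ n in atTop, ∃ R ∈ Set.Ioo (0 : ℝ) 1, u n R = ε * μ n ∧ |μ n * m n R - 2| ≤ ε ∧
      |Real.log (1 / lam n)| ≤ 3 * ε * μ n ^ 2 := by
  have hδ : 0 < ε ^ 2 / 1000 := by positivity
  obtain ⟨T, hT⟩ := hf _ hδ
  have hsq : Tendsto (fun x : ℝ => ε ^ 2 / 1000 * x ^ 2) atTop atTop :=
    (tendsto_pow_atTop two_ne_zero).const_mul_atTop hδ
  have hlog : ∀ᶠ x : ℝ in atTop, Real.log (2 * x) ≤ ε ^ 2 / 1000 * x ^ 2 := by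
    filter_upwards [eventually_ge_atTop (2 / (ε ^ 2 / 1000)), eventually_gt_atTop 0] with x h1 h2
    rw [div_le_iff₀ hδ] at h1
    have := Real.log_le_sub_one_of_pos (mul_pos two_pos h2)
    nlinarith
  filter_upwards [hμ.eventually_ge_atTop 1, hμ.eventually_ge_atTop (T / ε), hμ.eventually hlog,
    (hsq.comp hμ).eventually_ge_atTop (|Real.log (f T)| + (1 + ε ^ 2 / 1000) * T ^ 2),
    ((tendsto_id.const_mul_atTop hδ).comp hμ).eventually_gt_atTop 1] with n h1 h2 h3 h4 h5
  refine (hS n).exists_radius hT hε hε2 rfl h1 ?_ ?_ h4 h3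
  · rw [← mul_pow]
    exact one_lt_pow₀ h5 two_ne_zero
  · rw [div_le_iff₀ hε] at h2
    linarith

/-- Theorem 1.3 of the paper, the critical case `p = 2`. -/
theorem statement6
    (p : ℝ) (hp : p = 2)
    (h : ℝ → ℝ)
    (hhC1 : ContDiffOn ℝ 1 h (Set.Ici 0))
    (hhnonneg : ∀ t : ℝ, 0 ≤ t → 0 ≤ h t)
    (t₀ : ℝ) (ht₀ : 0 < t₀) (hhpos : ∀ t : ℝ, t₀ ≤ t → 0 < h t)
    (f : ℝ → ℝ) (hf : ∀ t : ℝ, f t = h t * Real.exp (t ^ p))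
    (H1 : Tendsto (fun t : ℝ => deriv h t / (t ^ (p - 1) * h t)) atTop (nhds 0))
    (lam μ : ℕ → ℝ) (u : ℕ → ℝ → ℝ)
    (hlam : ∀ n, 0 < lam n) (hμ : ∀ n, 0 < μ n)
    (huC2 : ∀ n, ContDiffOn ℝ 2 (u n) (Set.Icc 0 1))
    (hupos : ∀ n, ∀ r ∈ Set.Ico (0:ℝ) 1, 0 < u n r)
    (hu0 : ∀ n, u n 0 = μ n)
    (hu'0 : ∀ n, deriv (u n) 0 = 0)
    (hu1 : ∀ n, u n 1 = 0)
    (heq : ∀ n, ∀ r ∈ Set.Ioo (0:ℝ) 1,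
      -(deriv (deriv (u n)) r) - deriv (u n) r / r = lam n * f (u n r))
    (hmuInf : Tendsto μ atTop atTop) :
    ∃ φ : ℕ → ℕ, StrictMono φ ∧ ∃ r : ℕ → ℝ,
      (∀ n, r n ∈ Set.Ioo (0:ℝ) 1) ∧
      Tendsto (fun n => u (φ n) (r n) / μ (φ n)) atTop (nhds 0) ∧
      Tendsto (fun n =>
          2 * μ (φ n) * ∫ x in (0:ℝ)..(r n), lam (φ n) * f (u (φ n) x) * x)
        atTop (nhds 4) ∧
      Tendsto (fun n => Real.log (1 / lam (φ n)) / μ (φ n) ^ 2)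
        atTop (nhds 0) := by
  subst hp
  have hf2 : f = fun t => h t * Real.exp (t ^ 2) := by
    funext t
    rw [hf, Real.rpow_two]
  have H2 : Tendsto (fun t : ℝ => deriv h t / (t * h t)) atTop (nhds 0) := by
    refine H1.congr fun t => ?_
    norm_num
  have hfc : ContinuousOn f (Set.Ici 0) := by
    have := hhC1.continuousOn
    rw [hf2]
    fun_prop
  have hf0 : ∀ t, 0 ≤ t → 0 ≤ f t := fun t ht => by
    rw [hf]
    exact mul_nonneg (hhnonneg t ht) (Real.exp_pos _).le
  have hS := fun n => RadialSystem.of_solution hfc hf0 (hlam n) (huC2 n) (hupos n) (hu0 n) (hu1 n)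
    (heq n)
  have hev := fun {ε : ℝ} => eventually_exists_radius (ε := ε) hS
    (fun δ hδ => hf2 ▸ exists_gaussianGrowth hhC1 ht₀ hhpos H2 hδ) hmuInf
  have hloglim : Tendsto (fun n => Real.log (1 / lam n) / μ n ^ 2) atTop (nhds 0) := by
    rw [Metric.tendsto_nhds]
    intro ε hε
    filter_upwards [hev (ε := min (ε / 6) (1 / 2)) (by positivity) (min_le_right _ _)]
      with n ⟨_, _, _, _, hn⟩
    have h1 := pow_pos (hμ n) 2
    rw [Real.dist_eq, sub_zero, abs_div, abs_of_pos h1, div_lt_iff₀ h1]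
    have h2 : 3 * min (ε / 6) (1 / 2) * μ n ^ 2 ≤ 3 * (ε / 6) * μ n ^ 2 := by
      gcongr
      exact min_le_left _ _
    nlinarith
  have hε : ∀ k : ℕ, 0 < 1 / ((k : ℝ) + 2) ∧ 1 / ((k : ℝ) + 2) ≤ 1 / 2 := fun k =>
    ⟨by positivity, one_div_le_one_div_of_le two_pos (by linarith [k.cast_nonneg (α := ℝ)])⟩
  obtain ⟨φ, hφ, hR⟩ := extraction_forall_of_eventually fun k => hev (hε k).1 (hε k).2
  choose r hr hur hmr _ using hR
  have hlim : Tendsto (fun k : ℕ => 1 / ((k : ℝ) + 2)) atTop (nhds 0) :=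
    tendsto_const_nhds.div_atTop
      (tendsto_atTop_add_const_right _ _ tendsto_natCast_atTop_atTop)
  refine ⟨φ, hφ, r, hr, ?_, ?_, hloglim.comp hφ.tendsto_atTop⟩
  · refine hlim.congr fun k => ?_
    rw [hur, mul_div_cancel_right₀ _ (hμ _).ne']
  · have h1 : Tendsto (fun k => μ (φ k) * ∫ x in (0 : ℝ)..(r k), lam (φ k) * f (u (φ k) x) * x)
        atTop (nhds 2) := by
      rw [tendsto_iff_dist_tendsto_zero]
      exact squeeze_zero (fun _ => dist_nonneg) hmr hlim
    have h2 := h1.const_mul 2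
    norm_num at h2
    simpa only [mul_assoc] using h2
end
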